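/- arXiv:2203.00470 — 6 statements merged into one kernel-verified Lean document; each statement's English description precedes it below -/
import Mathlib

section
/- Analytic Ax–Schanuel theorem for the algebraic torus (ℂ*)^n: Let n ≥ 1 and let f_1, …, f_n be entire functions such that the n functions z ↦ f_j(z) − f_j(0) (1 ≤ j ≤ n) are linearly independent over ℚ. Then among the 2n entire functions f_1, …, f_n, exp∘f_1, …, exp∘f_n there exist n+1 functions that are algebraically independent over ℂ; equivalently, the transcendence degree over ℂ of the family (f_1, …, f_n, e^{f_1}, …, e^{f_n}) is at least n+1. -/
open Complex

section

open Polynomial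

theorem Derivation.eq_zero_of_isAlgebraic {A K : Type*} [CommRing A] [IsDomain A] [Field K]
    [CharZero K] [Algebra A K] [FaithfulSMul A K] (d : Derivation A K K) {y : K}
    (hy : IsAlgebraic A y) : d y = 0 := by
  obtain ⟨p, hp, hpy⟩ := hy
  have : CharZero A := (algebraMap A K).charZero
  induction hn : p.natDegree using Nat.strong_induction_on generalizing p with
  | _ n ih =>
    subst hn
    by_cases hd : p.derivative = 0
    · rw [Polynomial.eq_C_of_derivative_eq_zero hd, aeval_C,
        FaithfulSMul.algebraMap_eq_zero_iff] at hpy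
      rw [Polynomial.eq_C_of_derivative_eq_zero hd, hpy, C_0] at hp
      exact absurd rfl hp
    · by_cases h0 : aeval y p.derivative = 0
      · refine ih _ (natDegree_derivative_lt fun h => hd ?_) _ hd h0 rfl
        rw [eq_C_of_natDegree_eq_zero h, derivative_C]
      · have := d.map_aeval p y
        rw [hpy, map_zero, smul_eq_mul] at this
        exact (mul_eq_zero.mp this.symm).resolve_left h0

/-- A derivation vanishing on a subalgebra, as a derivation over that subalgebra. -/
def Derivation.overSubalgebra {C K : Type*} [CommRing C] [CommRing K] [Algebra C K]
    (d : Derivation C K K) (S : Subalgebra C K) (h : ∀ s ∈ S, d s = 0) : Derivation S K K where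
  toFun := d
  map_add' := map_add d
  map_smul' s x := by simp [Subalgebra.smul_def, h s.1 s.2]
  map_one_eq_zero' := d.map_one_eq_zero
  leibniz' := d.leibniz

theorem Derivation.eq_zero_of_isAlgebraic_adjoin {C K : Type*} [CommRing C] [Field K] [CharZero K]
    [Algebra C K] (d : Derivation C K K) {s : Set K} (h : ∀ x ∈ s, d x = 0) {y : K}
    (hy : IsAlgebraic (Algebra.adjoin C s) y) : d y = 0 := by
  refine (d.overSubalgebra (Algebra.adjoin C s) fun x hx => ?_).eq_zero_of_isAlgebraic hy
  induction hx using Algebra.adjoin_induction with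
  | mem x hx => exact h x hx
  | algebraMap r => exact d.map_algebraMap r
  | add x y _ _ hx hy => rw [map_add, hx, hy, add_zero]
  | mul x y _ _ hx hy => rw [d.leibniz, hx, hy, smul_zero, smul_zero, add_zero]

/-- Derivations extend along formally étale algebras. -/
theorem Derivation.exists_extension (C : Type*) {A K M : Type*} [CommRing C] [CommRing A]
    [CommRing K] [AddCommGroup M] [Algebra C A] [Algebra C K] [Algebra A K] [IsScalarTower C A K]
    [Algebra.FormallyEtale A K] [Module C M] [Module A M] [Module K M] [IsScalarTower C K M]
    [IsScalarTower A K M] [IsScalarTower C A M]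
    (d : Derivation C A M) : ∃ D : Derivation C K M, ∀ a, D (algebraMap A K a) = d a := by
  let l : TensorProduct A K (Ω[A⁄C]) →ₗ[K] M := TensorProduct.AlgebraTensorModule.lift
    ((LinearMap.toSpanSingleton K _ d.liftKaehlerDifferential))
  let L : Ω[K⁄C] →ₗ[K] M :=
    l ∘ₗ (KaehlerDifferential.tensorKaehlerEquivOfFormallyEtale C A K).symm.toLinearMap
  refine ⟨L.compDer (KaehlerDifferential.D C K), fun a => ?_⟩
  simp [L, l, KaehlerDifferential.tensorKaehlerEquivOfFormallyEtale_symm_D_algebraMap]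

/-- A nonzero space of vectors stable under coordinatewise differentiation contains a nonzero
vector with constant coordinates. -/
theorem Derivation.exists_const_mem {C K ι : Type*} [CommRing C] [Field K] [Algebra C K] [Fintype ι]
    (D : Derivation C K K) (W : Submodule K (ι → K)) (hW : ∀ a ∈ W, (fun i => D (a i)) ∈ W)
    (h : W ≠ ⊥) : ∃ a ∈ W, a ≠ 0 ∧ ∀ i, D (a i) = 0 := by
  classical
  obtain ⟨b, hb, hb0⟩ := W.exists_mem_ne_zero_of_ne_bot h
  let P : ℕ → Prop := fun n => ∃ a ∈ W, a ≠ 0 ∧ (Finset.univ.filter (a · ≠ 0)).card = n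
  have hP : ∃ n, P n := ⟨_, b, hb, hb0, rfl⟩
  obtain ⟨a, ha, ha0, hn⟩ := Nat.find_spec hP
  obtain ⟨i, hi⟩ := Function.ne_iff.mp ha0
  refine ⟨(a i)⁻¹ • a, W.smul_mem _ ha, smul_ne_zero (inv_ne_zero hi) ha0, ?_⟩
  by_contra! hc
  obtain ⟨j, hj⟩ := hc
  refine Nat.find_min hP (m := (Finset.univ.filter fun k => D (((a i)⁻¹ • a) k) ≠ 0).card) ?_
    ⟨_, hW _ (W.smul_mem _ ha), Function.ne_iff.mpr ⟨j, hj⟩, rfl⟩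
  rw [← hn]
  refine Finset.card_lt_card ⟨fun k hk => ?_, fun hs => ?_⟩
  · simp only [Finset.mem_filter, Finset.mem_univ, true_and] at hk ⊢
    intro h0
    simp [h0] at hk
  · have := hs (Finset.mem_filter.mpr ⟨Finset.mem_univ i, hi⟩)
    simp only [Finset.mem_filter, Pi.smul_apply, smul_eq_mul, inv_mul_cancel₀ hi] at this
    exact this.2 D.map_one_eq_zero

theorem Algebra.FormallyEtale.of_isAlgebraic_field (A K : Type*) [CommRing A] [IsDomain A] [Field K]
    [CharZero K] [Algebra A K] [FaithfulSMul A K] [Algebra.IsAlgebraic A K] :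
    Algebra.FormallyEtale A K := by
  let := FractionRing.liftAlgebra A K
  have : CharZero (FractionRing A) := (algebraMap (FractionRing A) K).charZero
  have : Algebra.IsAlgebraic (FractionRing A) K :=
    (IsFractionRing.comap_isAlgebraic_iff (A := A) (K := FractionRing A) (C := K)).mp inferInstance
  have := Algebra.FormallyEtale.of_isLocalization (Rₘ := FractionRing A) (nonZeroDivisors A)
  have := Algebra.FormallyEtale.of_isSeparable (FractionRing A) K
  exact Algebra.FormallyEtale.comp A (FractionRing A) K

theorem exists_finset_algEquiv_sum_prod_mem {A K : Type*} [CommRing A] [IsDomain A] [Field K]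
    [CharZero K] [IsAlgClosed K]
    [Algebra A K] [FaithfulSMul A K] [Algebra.IsAlgebraic A K] (T : Set K) (hT : T.Finite) :
    ∃ G : Finset (K ≃ₐ[A] K), G.Nonempty ∧ ∀ x ∈ T,
      (∃ a b : A, b ≠ 0 ∧ ∑ g ∈ G, g x = algebraMap A K a / algebraMap A K b) ∧
      (∃ a b : A, b ≠ 0 ∧ ∏ g ∈ G, g x = algebraMap A K a / algebraMap A K b) := by
  classical
  let := FractionRing.liftAlgebra A K
  have : CharZero (FractionRing A) := (algebraMap (FractionRing A) K).charZero
  have : Algebra.IsAlgebraic (FractionRing A) K :=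
    (IsFractionRing.comap_isAlgebraic_iff (A := A) (K := FractionRing A) (C := K)).mp inferInstance
  have : IsAlgClosure (FractionRing A) K := ⟨inferInstance, inferInstance⟩
  have : Normal (FractionRing A) K := IsAlgClosure.normal _ _
  have : IsGalois (FractionRing A) K := ⟨⟩
  have := hT.to_subtype
  let N := (FiniteGaloisIntermediateField.adjoin (FractionRing A) T).toIntermediateField
  have hfrac (y : FractionRing A) : ∃ a b : A, b ≠ 0 ∧
      algebraMap (FractionRing A) K y = algebraMap A K a / algebraMap A K b := by
    obtain ⟨a, b, hb, rfl⟩ := IsFractionRing.div_surjective (A := A) y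
    exact ⟨a, b, nonZeroDivisors.ne_zero hb, by
      rw [map_div₀, ← IsScalarTower.algebraMap_apply, ← IsScalarTower.algebraMap_apply]⟩
  let φ (g : N ≃ₐ[FractionRing A] N) : K ≃ₐ[A] K := (g.liftNormal K).restrictScalars A
  have hφ (g : N ≃ₐ[FractionRing A] N) (x : N) : φ g x = g x := g.liftNormal_commutes K x
  have hinj : Function.Injective φ := fun g h hgh => AlgEquiv.ext fun x => Subtype.ext <| by
    rw [← hφ, ← hφ, hgh]
  refine ⟨Finset.univ.image φ, Finset.univ_nonempty.image _, fun x hx => ?_⟩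
  have hxN : x ∈ N := FiniteGaloisIntermediateField.subset_adjoin _ _ hx
  lift x to N using hxN
  rw [Finset.sum_image hinj.injOn, Finset.prod_image hinj.injOn]
  simp only [hφ]
  constructor
  · convert hfrac (Algebra.trace (FractionRing A) N x)
    rw [IsScalarTower.algebraMap_apply (FractionRing A) N K, trace_eq_sum_automorphisms]
    simp
  · convert hfrac (Algebra.norm (FractionRing A) x)
    rw [IsScalarTower.algebraMap_apply (FractionRing A) N K, Algebra.norm_eq_prod_automorphisms]
    simp

namespace AxSchanuel

section Residue

variable {E K : Type*} [CommRing E] [Field K] [Algebra E K] {t : K}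

theorem aeval_ne_zero (ht : Transcendental E t) {q : E[X]} (hq : q ≠ 0) : aeval t q ≠ 0 :=
  fun h => hq (transcendental_iff.mp ht q h)

theorem derivation_aeval {δ : Derivation E K K} (hδ : δ t = 1) (p : E[X]) :
    δ (aeval t p) = aeval t p.derivative := by
  rw [δ.map_aeval, hδ, smul_eq_mul, mul_one]

theorem logDeriv_prod (δ : Derivation E K K) {ι : Type*} (s : Finset ι) (x : ι → K)
    (hx : ∀ i ∈ s, x i ≠ 0) : δ (∏ i ∈ s, x i) / ∏ i ∈ s, x i = ∑ i ∈ s, δ (x i) / x i := by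
  classical
  induction s using Finset.induction_on with
  | empty => simp
  | insert a s ha ih =>
    have h1 := hx a (by simp)
    have h2 := Finset.prod_ne_zero_iff.mpr fun i hi => hx i (Finset.mem_insert_of_mem hi)
    rw [Finset.prod_insert ha, Finset.sum_insert ha, ← ih fun i hi => hx i (by simp [hi]),
      δ.leibniz, smul_eq_mul, smul_eq_mul]
    field_simp
    ring

theorem algEquiv_derivation [CharZero K] (halg : ∀ y : K, IsAlgebraic (Algebra.adjoin E {t}) y)
    {δ : Derivation E K K} (hδ : δ t = 1) (g : K ≃ₐ[E] K) (hg : g t = t) (x : K) :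
    g (δ x) = δ (g x) := by
  let δ' : Derivation E K K := Derivation.mk' (g.toLinearMap ∘ₗ δ.toLinearMap ∘ₗ g.symm.toLinearMap)
    fun a b => by simp
  have hδ' (y : K) : δ' y = g (δ (g.symm y)) := rfl
  have hgs : g.symm t = t := by rw [AlgEquiv.symm_apply_eq, hg]
  have h := (δ' - δ).eq_zero_of_isAlgebraic_adjoin (s := {t}) (by simp [hδ', hgs, hδ])
    (halg (g x))
  simpa [hδ', sub_eq_zero] using h

theorem isAlgebraic_polynomial (ht : Transcendental E t)
    (halg : ∀ y : K, IsAlgebraic (Algebra.adjoin E {t}) y) :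
    letI : Algebra E[X] K := (aeval t).toAlgebra
    Algebra.IsAlgebraic E[X] K := by
  let : Algebra E[X] K := (aeval t).toAlgebra
  refine ⟨fun y => (halg y).ringHom_of_comp_eq (algEquivOfTranscendental E t ht).symm
    (RingHom.id K) (AlgEquiv.injective _) (RingHom.ext fun x => ?_)⟩
  obtain ⟨p, rfl⟩ := (algEquivOfTranscendental E t ht).surjective x
  change aeval t _ = (Subalgebra.val _) _
  rw [RingHom.coe_coe, AlgEquiv.symm_apply_apply, algEquivOfTranscendental_apply,
    ← aeval_algHom_apply]
  rfl

/-- `x` is a quotient of polynomials in `t` whose denominator does not vanish at `t = 0`. -/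
def IsRegular (E : Type*) {K : Type*} [CommRing E] [Field K] [Algebra E K] (t x : K) : Prop :=
  ∃ p q : E[X], q.coeff 0 ≠ 0 ∧ x * aeval t q = aeval t p

variable [IsDomain E]

theorem IsRegular.polynomial (p : E[X]) : IsRegular E t (aeval t p) := ⟨p, 1, by simp, by simp⟩

theorem IsRegular.add {x y : K} (hx : IsRegular E t x) (hy : IsRegular E t y) :
    IsRegular E t (x + y) := by
  obtain ⟨p, q, hq, h⟩ := hx
  obtain ⟨p', q', hq', h'⟩ := hy
  refine ⟨p * q' + p' * q, q * q', by simp [mul_coeff_zero, hq, hq'], ?_⟩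
  simp only [map_add, map_mul, ← h, ← h']
  ring

theorem IsRegular.mul {x y : K} (hx : IsRegular E t x) (hy : IsRegular E t y) :
    IsRegular E t (x * y) := by
  obtain ⟨p, q, hq, h⟩ := hx
  obtain ⟨p', q', hq', h'⟩ := hy
  refine ⟨p * p', q * q', by simp [mul_coeff_zero, hq, hq'], ?_⟩
  simp only [map_mul, ← h, ← h']
  ring

theorem IsRegular.of_mul_aeval {x : K} {q : E[X]} (hq : q.coeff 0 ≠ 0)
    (h : IsRegular E t (x * aeval t q)) : IsRegular E t x := by
  obtain ⟨p, q', hq', h'⟩ := h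
  refine ⟨p, q * q', by simp [mul_coeff_zero, hq, hq'], ?_⟩
  rw [map_mul, ← h', mul_assoc]

theorem IsRegular.const (c : E) : IsRegular E t (algebraMap E K c) := by
  simpa using IsRegular.polynomial (K := K) (t := t) (C c)

theorem IsRegular.self : IsRegular E t t := by
  simpa using IsRegular.polynomial (E := E) (t := t) X

theorem IsRegular.neg {x : K} (hx : IsRegular E t x) : IsRegular E t (-x) := by
  simpa using (IsRegular.const (-1 : E)).mul hx

theorem IsRegular.pow {x : K} (hx : IsRegular E t x) (n : ℕ) : IsRegular E t (x ^ n) := by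
  induction n with
  | zero => simpa using IsRegular.const (t := t) (1 : E)
  | succ n ih => simpa [pow_succ] using ih.mul hx

theorem IsRegular.sum {ι : Type*} {s : Finset ι} {x : ι → K} (hx : ∀ i ∈ s, IsRegular E t (x i)) :
    IsRegular E t (∑ i ∈ s, x i) := by
  classical
  induction s using Finset.induction_on with
  | empty => simpa using IsRegular.const (t := t) (0 : E)
  | insert a s ha ih =>
    rw [Finset.sum_insert ha]
    exact (hx a (by simp)).add (ih fun i hi => hx i (by simp [hi]))

theorem IsRegular.derivation {δ : Derivation E K K} (hδ : δ t = 1) {x : K}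
    (hx : IsRegular E t x) : IsRegular E t (δ x) := by
  obtain ⟨p, q, hq, h⟩ := hx
  have h2 := congrArg δ h
  rw [δ.leibniz, derivation_aeval hδ, derivation_aeval hδ, smul_eq_mul, smul_eq_mul] at h2
  refine ⟨p.derivative * q - p * q.derivative, q * q, by simp [mul_coeff_zero, hq], ?_⟩
  simp only [map_mul, map_sub, ← h, ← h2]
  ring

theorem eq_zero_of_isRegular_div (ht : Transcendental E t) {c : E}
    (h : IsRegular E t (algebraMap E K c / t)) : c = 0 := by
  obtain ⟨p, q, hq, h⟩ := h
  have ht0 : t ≠ 0 := by simpa using aeval_ne_zero ht (X_ne_zero (R := E))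
  have h1 : aeval t (C c * q - X * p) = 0 := by
    simp only [map_sub, map_mul, aeval_C, aeval_X, ← h]
    field_simp
    ring
  have h2 := congrArg (coeff · 0) (transcendental_iff.mp ht _ h1)
  simpa [mul_coeff_zero, hq] using h2

/-- An exact form has no residue. -/
theorem eq_zero_of_derivation_eq [CharZero K] [FaithfulSMul E K] (ht : Transcendental E t)
    {δ : Derivation E K K} (hδ : δ t = 1) {p q : E[X]} (hq : q ≠ 0) {c : E} {r : K}
    (hr : IsRegular E t r) (h : δ (aeval t p / aeval t q) = algebraMap E K c / t + r) : c = 0 := by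
  have : CharZero E := (algebraMap E K).charZero
  have ht0 : t ≠ 0 := by simpa using aeval_ne_zero ht (X_ne_zero (R := E))
  set s := aeval t p / aeval t q with hs
  have hex : ∃ m : ℕ, IsRegular E t (t ^ m * s) := by
    obtain ⟨q', hq', hd⟩ := q.exists_eq_pow_rootMultiplicity_mul_and_not_dvd hq 0
    rw [C_0, sub_zero] at hq' hd
    refine ⟨q.rootMultiplicity 0, .of_mul_aeval (q := q') (mt X_dvd_iff.mpr hd) ?_⟩
    convert IsRegular.polynomial (t := t) p using 1
    have h0 : aeval t q = t ^ q.rootMultiplicity 0 * aeval t q' := by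
      conv_lhs => rw [hq']
      simp
    have := aeval_ne_zero ht hq
    rw [mul_right_comm, ← h0, hs, mul_div_cancel₀ _ this]
  classical
  have hm := Nat.find_spec hex
  have hmin := fun k => Nat.find_min (m := k) hex
  rcases hfind : Nat.find hex with _ | m
  · rw [hfind, pow_zero, one_mul] at hm
    refine eq_zero_of_isRegular_div ht (t := t) ?_
    rw [eq_sub_of_add_eq h.symm, sub_eq_add_neg]
    exact (hm.derivation hδ).add hr.neg
  · rw [hfind] at hm hmin
    refine absurd (IsRegular.of_mul_aeval (q := C ((m + 1 : ℕ) : E)) ?_ ?_) (hmin m m.lt_succ_self)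
    · simpa using Nat.cast_add_one_ne_zero m
    · have hd := hm.derivation hδ
      convert (hd.add ((IsRegular.self.pow m).mul (IsRegular.const c)).neg).add
        ((IsRegular.self.pow (m + 1)).mul hr).neg using 1
      rw [δ.leibniz, δ.leibniz_pow, hδ, h]
      simp
      field_simp
      ring

theorem exists_logDeriv_eq (ht : Transcendental E t) {δ : Derivation E K K} (hδ : δ t = 1)
    {p : E[X]} (hp : p ≠ 0) :
    ∃ k : ℤ, IsRegular E t (δ (aeval t p) / aeval t p - k / t) := by
  obtain ⟨q, hq, hd⟩ := p.exists_eq_pow_rootMultiplicity_mul_and_not_dvd hp 0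
  rw [C_0, sub_zero] at hq hd
  have ht0 : t ≠ 0 := by simpa using aeval_ne_zero ht (X_ne_zero (R := E))
  have hq0 : q ≠ 0 := by rintro rfl; simp at hd
  have hqt := aeval_ne_zero ht hq0
  refine ⟨p.rootMultiplicity 0, .of_mul_aeval (q := q) (mt X_dvd_iff.mpr hd) ?_⟩
  convert IsRegular.polynomial (t := t) q.derivative using 1
  have h0 : aeval t p = t ^ p.rootMultiplicity 0 * aeval t q := by
    conv_lhs => rw [hq]
    simp
  rw [h0, δ.leibniz, δ.leibniz_pow, hδ, derivation_aeval hδ]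
  generalize p.rootMultiplicity 0 = n
  rcases n with _ | n
  · simp; field_simp
  · simp
    field_simp
    ring

theorem exists_logDeriv_div_eq (ht : Transcendental E t) {δ : Derivation E K K} (hδ : δ t = 1)
    {p q : E[X]} (hp : p ≠ 0) (hq : q ≠ 0) :
    ∃ k : ℤ, IsRegular E t (δ (aeval t p / aeval t q) / (aeval t p / aeval t q) - k / t) := by
  obtain ⟨k, hk⟩ := exists_logDeriv_eq ht hδ hp
  obtain ⟨l, hl⟩ := exists_logDeriv_eq ht hδ hq
  refine ⟨k - l, ?_⟩
  convert hk.add hl.neg using 1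
  have hpt := aeval_ne_zero ht hp
  have hqt := aeval_ne_zero ht hq
  rw [δ.leibniz_div]
  push_cast
  simp
  field_simp
  ring

theorem not_isExact_of_residue_ne_zero [CharZero K] [FaithfulSMul E K] [IsAlgClosed K]
    (ht : Transcendental E t) (halg : ∀ y : K, IsAlgebraic (Algebra.adjoin E {t}) y)
    {δ : Derivation E K K} (hδ : δ t = 1) {ι : Type*} [Fintype ι] {e : ι → E}
    (he : LinearIndependent ℤ e) {w : ι → K} (hw : ∀ i, w i ≠ 0) {i₀ : ι} (hi₀ : w i₀ = t) (v : K) :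
    δ v ≠ ∑ i, algebraMap E K (e i) * (δ (w i) / w i) := by
  intro h
  let : Algebra E[X] K := (aeval t).toAlgebra
  have hmap (p : E[X]) : algebraMap E[X] K p = aeval t p := rfl
  have : IsScalarTower E E[X] K := .of_algHom (aeval t)
  have : FaithfulSMul E[X] K := (faithfulSMul_iff_algebraMap_injective _ _).mpr
    (transcendental_iff_injective.mp ht)
  have : Algebra.IsAlgebraic E[X] K := isAlgebraic_polynomial ht halg
  obtain ⟨G, hG, hGT⟩ := exists_finset_algEquiv_sum_prod_mem (A := E[X]) (insert v (Set.range w))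
    ((Set.finite_range w).insert v)
  have hcomm (g : K ≃ₐ[E[X]] K) (x : K) : g (δ x) = δ (g x) :=
    algEquiv_derivation halg hδ (g.restrictScalars E) (by
      have := g.commutes X
      rwa [hmap, aeval_X] at this) x
  obtain ⟨a, b, hb, hab⟩ := (hGT v (by simp)).1
  choose p q hq hpq using fun i => (hGT (w i) (by simp)).2
  simp only [hmap] at hab hpq
  have hprod (i) : ∏ g ∈ G, g (w i) ≠ 0 :=
    Finset.prod_ne_zero_iff.mpr fun g _ => (map_ne_zero g).mpr (hw i)
  have hp (i) : p i ≠ 0 := by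
    intro h0
    apply hprod i
    simp [hpq, h0]
  choose k hk using fun i => exists_logDeriv_div_eq ht hδ (hp i) (hq i)
  have key : δ (aeval t a / aeval t b) = algebraMap E K (∑ i, k i • e i) / t +
      ∑ i, algebraMap E K (e i) * (δ (aeval t (p i) / aeval t (q i)) /
        (aeval t (p i) / aeval t (q i)) - k i / t) := by
    have h1 : ∑ g ∈ G, g (δ v) = ∑ i, algebraMap E K (e i) *
        (δ (aeval t (p i) / aeval t (q i)) / (aeval t (p i) / aeval t (q i))) := by
      simp only [← hpq]
      rw [h]
      simp only [map_sum, map_mul, map_div₀, hcomm]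
      rw [Finset.sum_comm]
      refine Finset.sum_congr rfl fun i _ => ?_
      rw [logDeriv_prod _ _ _ fun g _ => (map_ne_zero g).mpr (hw i), Finset.mul_sum]
      refine Finset.sum_congr rfl fun g _ => ?_
      rw [IsScalarTower.algebraMap_apply E E[X] K, g.commutes]
    rw [← hab, map_sum]
    simp only [← hcomm]
    rw [h1, map_sum, Finset.sum_div, ← Finset.sum_add_distrib]
    refine Finset.sum_congr rfl fun i _ => ?_
    rw [map_zsmul, zsmul_eq_mul]
    ring
  have hzero := eq_zero_of_derivation_eq ht hδ hb
    (IsRegular.sum fun i _ => (IsRegular.const (e i)).mul (hk i)) key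
  have hk0 := Fintype.linearIndependent_iff.mp he k hzero i₀
  have h2 := hk i₀
  have ht0 : t ≠ 0 := by simpa using aeval_ne_zero ht (X_ne_zero (R := E))
  have hgt (g : K ≃ₐ[E[X]] K) : g t = t := by
    have := g.commutes X
    rwa [hmap, aeval_X] at this
  rw [← hpq, logDeriv_prod _ _ _ fun g _ => (map_ne_zero g).mpr (hw i₀), hk0] at h2
  simp only [hi₀, hgt, hδ] at h2
  have : CharZero E := (algebraMap E K).charZero
  have h3 := eq_zero_of_isRegular_div ht (c := (G.card : E)) (by simpa [div_eq_mul_inv] using h2)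
  exact hG.card_ne_zero (by exact_mod_cast h3)

end Residue

theorem isAlgebraic_of_logForm_exact {C K : Type*} [Field C] [Field K] [CharZero K] [IsAlgClosed K]
    [Algebra C K] {ι : Type*} [Fintype ι] {e : ι → C} (he : LinearIndependent ℤ e) {w : ι → K}
    (hw : ∀ i, w i ≠ 0) {v : K}
    (h : ∀ δ : Derivation C K K, δ v = ∑ i, algebraMap C K (e i) * (δ (w i) / w i)) (i₀ : ι) :
    IsAlgebraic C (w i₀) := by
  by_contra ht
  set t := w i₀ with hi₀
  obtain ⟨B, htB, hB⟩ := exists_isTranscendenceBasis_superset (R := C) (s := {t})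
    ((algebraicIndependent_singleton_iff (⟨t, rfl⟩ : ({t} : Set K))).mpr ht)
  let E := Algebra.adjoin C (B \ {t})
  have htE : Transcendental E t := by
    have h := AlgebraicIndependent.transcendental_adjoin (x := ((↑) : B → K)) hB.1
      (s := {x | x.1 ≠ t}) (i := ⟨t, htB rfl⟩) (by simp)
    have hBt : ((↑) : B → K) '' {x | x.1 ≠ t} = B \ {t} := by ext x; simp [and_comm]
    rwa [hBt] at h
  have halg (y : K) : IsAlgebraic (Algebra.adjoin E {t}) y := by
    have h := hB.isAlgebraic.isAlgebraic y
    rw [Subtype.range_coe, ← Set.sdiff_union_of_subset htB,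
      Algebra.adjoin_union_eq_adjoin_adjoin] at h
    exact h
  let : Algebra E[X] K := (aeval t).toAlgebra
  have hmap (p : E[X]) : algebraMap E[X] K p = aeval t p := rfl
  have : IsScalarTower E E[X] K := .of_algHom (aeval t)
  have : FaithfulSMul E[X] K := (faithfulSMul_iff_algebraMap_injective _ _).mpr
    (transcendental_iff_injective.mp htE)
  have : Algebra.IsAlgebraic E[X] K := isAlgebraic_polynomial htE halg
  have := Algebra.FormallyEtale.of_isAlgebraic_field E[X] K
  obtain ⟨δ, hδ⟩ := (mkDerivation E (1 : K)).exists_extension E (K := K)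
  have hδt : δ t = 1 := by
    have := hδ X
    rwa [hmap, aeval_X, mkDerivation_X] at this
  refine not_isExact_of_residue_ne_zero htE halg hδt (e := fun i => algebraMap C E (e i)) ?_ hw
    (i₀ := i₀) hi₀.symm v (h (δ.restrictScalars C))
  exact he.map' ((Algebra.linearMap C E).restrictScalars ℤ)
    (LinearMap.ker_eq_bot.mpr (FaithfulSMul.algebraMap_injective C E))

theorem exists_linear_relation {C K ι : Type*} [Field C] [Field K] [CharZero K] [Algebra C K]
    [Fintype ι] (D : Derivation C K K) {y z : ι → K} (hz : ∀ i, z i ≠ 0)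
    (hyz : ∀ i, D (y i) = D (z i) / z i) {i₀ : ι} (hi₀ : D (y i₀) ≠ 0) {S : Set K} [Fintype S]
    (hS : Fintype.card S ≤ Fintype.card ι)
    (hy : ∀ i, IsAlgebraic (Algebra.adjoin C S) (y i))
    (hz' : ∀ i, IsAlgebraic (Algebra.adjoin C S) (z i)) :
    ∃ a : ι → K, a ≠ 0 ∧ (∀ i, D (a i) = 0) ∧
      ∀ δ : Derivation C K K, ∑ i, a i * (δ (y i) - δ (z i) / z i) = 0 := by
  classical
  let ω : Derivation C K K →ₗ[K] (ι → K) :=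
    { toFun δ i := δ (y i) - δ (z i) / z i
      map_add' δ ε := by ext i; simp; ring
      map_smul' c δ := by ext i; simp; ring }
  have hω (δ i) : ω δ i = δ (y i) - δ (z i) / z i := rfl
  let ρ : Derivation C K K →ₗ[K] (S → K) :=
    { toFun δ s := δ s
      map_add' δ ε := rfl
      map_smul' c δ := rfl }
  have hker {δ} (h : ρ δ = 0) {x : K} (hx : IsAlgebraic (Algebra.adjoin C S) x) : δ x = 0 :=
    δ.eq_zero_of_isAlgebraic_adjoin (fun s hs => congrFun h ⟨s, hs⟩) hx
  have hle : LinearMap.ker ρ ≤ LinearMap.ker ω := fun δ h => by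
    ext i
    rw [hω, hker h (hy i), hker h (hz' i)]
    simp
  let ψ := (LinearMap.ker ρ).liftQ ω hle
  have : Module.Finite K (Derivation C K K ⧸ LinearMap.ker ρ) :=
    Module.Finite.equiv ρ.quotKerEquivRange.symm
  have hQ : Module.finrank K (Derivation C K K ⧸ LinearMap.ker ρ) ≤ Fintype.card ι := by
    rw [ρ.quotKerEquivRange.finrank_eq]
    exact (Submodule.finrank_le _).trans (by simpa using hS)
  have hψ : 0 < Module.finrank K (LinearMap.ker ψ) := by
    have hD : (LinearMap.ker ρ).mkQ D ∈ LinearMap.ker ψ := by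
      rw [LinearMap.mem_ker, Submodule.mkQ_apply, Submodule.liftQ_apply]
      ext i
      rw [hω, hyz, sub_self, Pi.zero_apply]
    have hD0 : (⟨_, hD⟩ : LinearMap.ker ψ) ≠ 0 := by
      intro h
      have h1 : (LinearMap.ker ρ).mkQ D = 0 := congrArg Subtype.val h
      rw [Submodule.mkQ_apply, Submodule.Quotient.mk_eq_zero] at h1
      exact hi₀ (hker h1 (hy i₀))
    exact Module.finrank_pos_iff_exists_ne_zero.mpr ⟨_, hD0⟩
  have hlt : LinearMap.range ψ < ⊤ := by
    rw [lt_top_iff_ne_top]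
    intro h
    have h1 := ψ.finrank_range_add_finrank_ker
    rw [h, finrank_top, Module.finrank_fintype_fun_eq_card] at h1
    omega
  obtain ⟨f, hf0, hf⟩ := Submodule.exists_le_ker_of_lt_top _ hlt
  let W : Submodule K (ι → K) :=
    { carrier := {a | ∀ δ, ∑ i, a i * ω δ i = 0}
      zero_mem' δ := by simp
      add_mem' {a b} ha hb δ := by
        simp only [Pi.add_apply, add_mul, Finset.sum_add_distrib]
        rw [ha, hb, add_zero]
      smul_mem' c a ha δ := by
        simp only [Pi.smul_apply, smul_eq_mul, mul_assoc, ← Finset.mul_sum]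
        rw [ha, mul_zero] }
  have hW : ∀ a ∈ W, (fun i => D (a i)) ∈ W := by
    intro a ha δ
    have h1 := congrArg D (ha δ)
    have h2 := ha ⁅D, δ⁆
    have h3 (i) : ω ⁅D, δ⁆ i = D (ω δ i) := by
      have h4 := congrArg δ (hyz i)
      simp only [hω, Derivation.commutator_apply, map_sub, Derivation.leibniz_div, h4, smul_eq_mul]
      have := hz i
      field_simp
      ring
    simp only [map_sum, map_zero, Derivation.leibniz, Finset.sum_add_distrib, smul_eq_mul] at h1
    simp only [h3] at h2
    rw [h2, zero_add] at h1
    simpa only [mul_comm] using h1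
  have hne : W ≠ ⊥ := by
    have hfx (x : ι → K) : f x = ∑ i, f (Pi.single i 1) * x i := by
      conv_lhs => rw [pi_eq_sum_univ' x, map_sum]
      refine Finset.sum_congr rfl fun i _ => ?_
      rw [map_smul, smul_eq_mul, mul_comm]
    refine (Submodule.ne_bot_iff _).mpr ⟨fun i => f (Pi.single i 1), fun δ => ?_, fun h => hf0 ?_⟩
    · rw [← hfx]
      exact hf ⟨(LinearMap.ker ρ).mkQ δ, rfl⟩
    · ext i
      simpa using congrFun h i
  obtain ⟨a, ha, ha0, hDa⟩ := D.exists_const_mem W hW hne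
  exact ⟨a, ha0, hDa, ha⟩

/-- **Ax's theorem** for one derivation, in contrapositive form. -/
theorem exists_int_relation {C K ι : Type*} [Field C] [Field K] [CharZero K] [IsAlgClosed K]
    [Algebra C K] [Fintype ι]
    (D : Derivation C K K) (hD : ∀ x, D x = 0 → x ∈ Set.range (algebraMap C K))
    {y z : ι → K} (hz : ∀ i, z i ≠ 0) (hyz : ∀ i, D (y i) = D (z i) / z i)
    {i₀ : ι} (hi₀ : D (y i₀) ≠ 0) {S : Set K} [Fintype S] (hS : Fintype.card S ≤ Fintype.card ι)
    (hy : ∀ i, IsAlgebraic (Algebra.adjoin C S) (y i))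
    (hz' : ∀ i, IsAlgebraic (Algebra.adjoin C S) (z i)) :
    ∃ m : ι → ℤ, m ≠ 0 ∧ ∑ i, m i * D (y i) = 0 := by
  obtain ⟨a, ha0, hDa, ha⟩ := exists_linear_relation D hz hyz hi₀ hS hy hz'
  choose c hc using fun i => hD _ (hDa i)
  have : CharZero C := (algebraMap C K).charZero
  let H := Submodule.span ℤ (Set.range c)
  have : Module.Finite ℤ H := Module.Finite.span_of_finite ℤ (Set.finite_range c)
  let b := Module.Free.chooseBasis ℤ H
  let m (i : ι) := b.repr ⟨c i, Submodule.subset_span ⟨i, rfl⟩⟩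
  have hm (i) : c i = ∑ j, m i j * (b j : C) := by
    have := congrArg Subtype.val (b.sum_repr ⟨c i, Submodule.subset_span ⟨i, rfl⟩⟩)
    simp only [AddSubmonoidClass.coe_finsetSum, Submodule.coe_smul, zsmul_eq_mul] at this
    exact this.symm
  obtain ⟨i₁, hi₁⟩ := Function.ne_iff.mp ha0
  obtain ⟨j, hj⟩ : ∃ j, m i₁ j ≠ 0 := by
    by_contra! h
    apply hi₁
    rw [← hc, hm]
    simp [h]
  let w j := ∏ i, z i ^ m i j
  have hw (j) : w j ≠ 0 := Finset.prod_ne_zero_iff.mpr fun i _ => zpow_ne_zero _ (hz i)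
  have hlog (δ : Derivation C K K) (j) : δ (w j) / w j = ∑ i, m i j * (δ (z i) / z i) := by
    rw [logDeriv_prod δ _ _ fun i _ => zpow_ne_zero _ (hz i)]
    refine Finset.sum_congr rfl fun i _ => ?_
    rw [δ.leibniz_zpow]
    have := hz i
    simp [zpow_sub₀ this]
    field_simp
  have halg := isAlgebraic_of_logForm_exact (e := fun j => (b j : C)) (v := ∑ i, c i • y i)
    (b.linearIndependent.map' H.subtype (by simp)) hw (fun δ => ?_) j
  · refine ⟨fun i => m i j, Function.ne_iff.mpr ⟨i₁, hj⟩, ?_⟩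
    have := hlog D j
    rw [D.eq_zero_of_isAlgebraic halg, zero_div] at this
    simp only [hyz, ← this]
  · have h1 := ha δ
    simp only [mul_sub, Finset.sum_sub_distrib, sub_eq_zero] at h1
    simp only [hlog, Finset.mul_sum]
    rw [map_sum, Finset.sum_comm]
    have h3 (i) : ∑ j, algebraMap C K (b j) * (m i j * (δ (z i) / z i)) =
        a i * (δ (z i) / z i) := by
      rw [← hc, hm, map_sum, Finset.sum_mul]
      refine Finset.sum_congr rfl fun j _ => ?_
      rw [map_mul, map_intCast]
      ring
    simp only [h3, δ.map_smul_of_tower]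
    simp only [Algebra.smul_def, hc, h1]

theorem mem_range_algebraMap_of_derivation_eq_zero {C F K : Type*} [Field C] [IsAlgClosed C]
    [Field F] [Field K] [Algebra C F] [Algebra C K] [Algebra F K] [IsScalarTower C F K]
    [Algebra.IsAlgebraic F K] (d : Derivation C F F) (D : Derivation C K K)
    (hD : ∀ a, D (algebraMap F K a) = algebraMap F K (d a))
    (hd : ∀ a, d a = 0 → a ∈ Set.range (algebraMap C F)) {x : K} (hx : D x = 0) :
    x ∈ Set.range (algebraMap C K) := by
  have hxi : IsIntegral F x := Algebra.IsIntegral.isIntegral x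
  set p := minpoly F x
  have hpc (q : F[X]) :
      D (aeval x q) =
        ∑ i ∈ Finset.range (q.natDegree + 1), algebraMap F K (d (q.coeff i)) * x ^ i := by
    rw [aeval_eq_sum_range, map_sum]
    refine Finset.sum_congr rfl fun i _ => ?_
    rw [Algebra.smul_def, D.leibniz, D.leibniz_pow, hx, hD]
    simp [mul_comm]
  let q : F[X] := ∑ i ∈ Finset.range p.natDegree, monomial i (d (p.coeff i))
  have hq0 : aeval x q = 0 := by
    have h := hpc p
    rw [minpoly.aeval, map_zero, Finset.sum_range_succ, (minpoly.monic hxi).coeff_natDegree,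
      d.map_one_eq_zero, map_zero, zero_mul, add_zero] at h
    simpa [q, aeval_monomial] using h.symm
  have hq : q = 0 := by
    by_contra h
    refine (minpoly.degree_le_of_ne_zero F x h hq0).not_gt ?_
    rw [degree_eq_natDegree (minpoly.ne_zero hxi), degree_lt_iff_coeff_zero]
    intro m hm
    rw [finsetSum_coeff]
    refine Finset.sum_eq_zero fun i hi => coeff_monomial_of_ne _ ?_
    exact ((Finset.mem_range.mp hi).trans_le hm).ne'
  have hcoeff (i) : d (p.coeff i) = 0 := by
    rcases lt_trichotomy i p.natDegree with hi | rfl | hi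
    · have := congrArg (coeff · i) hq
      simpa [q, coeff_monomial, hi] using this
    · rw [(minpoly.monic hxi).coeff_natDegree, d.map_one_eq_zero]
    · rw [coeff_eq_zero_of_natDegree_lt hi, map_zero]
  obtain ⟨r, hr⟩ : ∃ r : C[X], r.map (algebraMap C F) = p := by
    rw [← mem_lifts, lifts_iff_coeff_lifts]
    exact fun i => hd _ (hcoeff i)
  have hr0 : r ≠ 0 := by
    rintro rfl
    exact minpoly.ne_zero hxi (by simpa using hr.symm)
  have hxC : IsAlgebraic C x := ⟨r, hr0, by
    rw [← aeval_map_algebraMap F, hr, minpoly.aeval]⟩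
  exact minpoly.mem_range_of_degree_eq_one C x
    (IsAlgClosed.degree_eq_one_of_irreducible C (minpoly.irreducible hxC.isIntegral))

/-- The algebra of entire functions. -/
def entire : Subalgebra ℂ (ℂ → ℂ) where
  carrier := {f | Differentiable ℂ f}
  mul_mem' := Differentiable.mul
  add_mem' := Differentiable.add
  algebraMap_mem' c := differentiable_const c

theorem analyticOnNhd_entire (f : entire) : AnalyticOnNhd ℂ (f : ℂ → ℂ) Set.univ :=
  fun z _ => Differentiable.analyticAt f.2 z

instance : IsDomain entire := by
  have : NoZeroDivisors entire := ⟨fun {f g} h => by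
    have h1 := (analyticOnNhd_entire f).eq_zero_or_eq_zero_of_mul_eq_zero (analyticOnNhd_entire g)
      (fun z _ => congrFun (congrArg Subtype.val h) z) isPreconnected_univ
    exact h1.imp (fun h => Subtype.ext (funext fun z => h z trivial))
      (fun h => Subtype.ext (funext fun z => h z trivial))⟩
  exact NoZeroDivisors.to_isDomain _

/-- Differentiation of entire functions. -/
noncomputable def entireDeriv : Derivation ℂ entire entire :=
  Derivation.mk'
    { toFun f := ⟨deriv f, fun z => (analyticOnNhd_entire f z trivial).deriv.differentiableAt⟩
      map_add' f g := Subtype.ext (funext fun z => deriv_add (f.2 z) (g.2 z))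
      map_smul' c f := Subtype.ext (funext fun z => deriv_const_smul c (f.2 z)) }
    fun f g => Subtype.ext (funext fun z => by
      simpa [mul_comm, add_comm] using deriv_mul (f.2 z) (g.2 z))

@[simp]
theorem coe_entireDeriv (f : entire) : (entireDeriv f : ℂ → ℂ) = deriv f := rfl

theorem exists_eq_smul_of_wronskian_eq_zero {f g : entire} (hg : g ≠ 0)
    (h : g * entireDeriv f = f * entireDeriv g) : ∃ c : ℂ, f = c • g := by
  obtain ⟨z₀, hz₀⟩ : ∃ z, (g : ℂ → ℂ) z ≠ 0 := by
    by_contra! h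
    exact hg (Subtype.ext (funext h))
  obtain ⟨r, hr, hgr⟩ := Metric.eventually_nhds_iff_ball.mp
    ((g.2 z₀).continuousAt.eventually_ne hz₀)
  obtain ⟨c, hc⟩ := Metric.isOpen_ball.exists_is_const_of_deriv_eq_zero
    (f := (f : ℂ → ℂ) / (g : ℂ → ℂ)) (convex_ball z₀ r).isPreconnected
    (fun z hz => ((f.2 z).div (g.2 z) (hgr z hz)).differentiableWithinAt) (fun z hz => by
      have := congrFun (congrArg Subtype.val h) z
      simp at this
      rw [deriv_div (f.2 z) (g.2 z) (hgr z hz), mul_comm, this, sub_self, zero_div, Pi.zero_apply])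
  refine ⟨c, Subtype.ext ?_⟩
  refine (analyticOnNhd_entire f).eq_of_eventuallyEq (analyticOnNhd_entire (c • g)) (z₀ := z₀) ?_
  filter_upwards [Metric.ball_mem_nhds z₀ hr] with z hz
  exact (div_eq_iff (hgr z hz)).mp (hc z hz)

/-- The derivation `d / dz` of the algebra of entire functions extends to an algebraically closed
field without acquiring new constants. -/
theorem exists_derivation_entire (F K : Type*) [Field F] [Field K] [Algebra ℂ F] [Algebra ℂ K]
    [Algebra entire F] [Algebra entire K] [Algebra F K] [IsScalarTower ℂ entire F]
    [IsScalarTower ℂ F K] [IsScalarTower entire F K] [IsFractionRing entire F]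
    [Algebra.IsAlgebraic F K] : ∃ D : Derivation ℂ K K,
    (∀ f, D (algebraMap entire K f) = algebraMap entire K (entireDeriv f)) ∧
      ∀ x, D x = 0 → x ∈ Set.range (algebraMap ℂ K) := by
  have := Algebra.FormallyEtale.of_isLocalization (Rₘ := F) (nonZeroDivisors entire)
  obtain ⟨d, hd⟩ := ((Algebra.linearMap entire F).compDer entireDeriv).exists_extension ℂ (K := F)
  replace hd (f) : d (algebraMap entire F f) = algebraMap entire F (entireDeriv f) := hd f
  have : CharZero K := charZero_of_injective_algebraMap (algebraMap ℂ K).injective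
  have := Algebra.FormallyEtale.of_isAlgebraic_field F K
  obtain ⟨D, hD⟩ := ((Algebra.linearMap F K).compDer d).exists_extension ℂ (K := K)
  replace hD (a) : D (algebraMap F K a) = algebraMap F K (d a) := hD a
  refine ⟨D, fun f => ?_, fun x hx =>
    mem_range_algebraMap_of_derivation_eq_zero d D hD (fun a ha => ?_) hx⟩
  · rw [IsScalarTower.algebraMap_apply entire F, hD, hd, ← IsScalarTower.algebraMap_apply]
  · obtain ⟨f, g, hg, rfl⟩ := IsFractionRing.div_surjective (A := entire) a
    have hg0 := nonZeroDivisors.ne_zero hg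
    have hg1 : algebraMap entire F g ≠ 0 := by simpa using hg0
    simp only [d.leibniz_div, hd, smul_eq_mul, mul_eq_zero, inv_eq_zero, pow_eq_zero_iff, hg1,
      ne_eq, OfNat.ofNat_ne_zero, not_false_eq_true, false_or, sub_eq_zero, ← map_mul] at ha
    obtain ⟨c, rfl⟩ := exists_eq_smul_of_wronskian_eq_zero hg0 (IsFractionRing.injective _ _ ha)
    refine ⟨c, ?_⟩
    rw [eq_div_iff hg1, ← Algebra.smul_def,
      algebra_compatible_smul entire c (algebraMap entire F g), algebra_compatible_smul entire c g,
      smul_eq_mul, map_mul, Algebra.smul_def]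

/-- Either `k + 1` members of a finite family are algebraically independent, or at most `k` of
its members suffice to make all others algebraic. -/
theorem exists_algebraicIndepOn_card_or {R K ι : Type*} [Field R] [Field K] [Algebra R K]
    [Fintype ι] (x : ι → K) (k : ℕ) :
    (∃ s : Finset ι, s.card = k + 1 ∧ AlgebraicIndepOn R x s) ∨
      ∃ s : Finset ι, s.card ≤ k ∧ ∀ i, IsAlgebraic (Algebra.adjoin R (x '' s)) (x i) := by
  classical
  obtain ⟨s, hs, hmax⟩ := Finset.exists_max_image
    (Finset.univ.filter fun s : Finset ι => AlgebraicIndepOn R x s) Finset.card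
    ⟨∅, by
      simp only [Finset.mem_filter, Finset.mem_univ, true_and, Finset.coe_empty]
      exact algebraicIndependent_empty_type_iff.mpr (FaithfulSMul.algebraMap_injective R K)⟩
  simp only [Finset.mem_filter, Finset.mem_univ, true_and] at hs hmax
  rcases le_or_gt s.card k with h | h
  · refine Or.inr ⟨s, h, fun i => ?_⟩
    by_contra hi
    have his : i ∉ s := fun his => hi <| isAlgebraic_algebraMap
      (⟨_, Algebra.subset_adjoin ⟨i, his, rfl⟩⟩ : Algebra.adjoin R (x '' s))
    have := hmax (insert i s) (by rw [Finset.coe_insert]; exact hs.insert hi)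
    rw [Finset.card_insert_of_notMem his] at this
    omega
  · obtain ⟨t, hts, ht⟩ := Finset.exists_subset_card_eq h
    exact Or.inl ⟨t, ht, hs.mono (Finset.coe_subset.mpr hts)⟩

/-- The Ax–Schanuel theorem, given a field `F` of meromorphic functions and its algebraic
closure `K`. -/
theorem exists_algebraicIndependent (F K : Type*) [Field F] [Field K] [IsAlgClosed K] [Algebra ℂ F]
    [Algebra ℂ K] [Algebra entire F] [Algebra entire K] [Algebra F K] [IsScalarTower ℂ entire F]
    [IsScalarTower ℂ F K] [IsScalarTower entire F K] [IsScalarTower ℂ entire K]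
    [IsFractionRing entire F] [Algebra.IsAlgebraic F K]
    {n : ℕ} (hn : 1 ≤ n)
    {f : Fin n → ℂ → ℂ} (hf : ∀ j, Differentiable ℂ (f j))
    (hQ : LinearIndependent ℚ (fun j : Fin n => fun z : ℂ => f j z - f j 0)) :
    ∃ s : Finset (Fin n ⊕ Fin n), s.card = n + 1 ∧
      AlgebraicIndependent ℂ
        (fun i : s => Sum.elim f (fun j => fun z : ℂ => Complex.exp (f j z)) (i : Fin n ⊕ Fin n)) := by
  classical
  obtain ⟨D, hD, hDc⟩ := exists_derivation_entire F K
  have : CharZero K := charZero_of_injective_algebraMap (algebraMap ℂ K).injective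
  let u (j) : entire := ⟨f j, hf j⟩
  let v (j) : entire := ⟨fun z => Complex.exp (f j z), (hf j).cexp⟩
  let y (j) : K := algebraMap entire K (u j)
  let z (j) : K := algebraMap entire K (v j)
  have hinj : Function.Injective (algebraMap entire K) := by
    rw [IsScalarTower.algebraMap_eq entire F K]
    exact (algebraMap F K).injective.comp (IsFractionRing.injective _ _)
  have hconst (g : entire) (hg : entireDeriv g = 0) (w : ℂ) : (g : ℂ → ℂ) w - (g : ℂ → ℂ) 0 = 0 :=
    sub_eq_zero.mpr (is_const_of_deriv_eq_zero g.2
      (fun w => congrFun (congrArg Subtype.val hg) w) w 0)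
  have hz (j) : z j ≠ 0 := by
    refine (map_ne_zero_iff _ hinj).mpr fun h => ?_
    exact Complex.exp_ne_zero (f j 0) (congrFun (congrArg Subtype.val h) 0)
  have hyz (j) : D (y j) = D (z j) / z j := by
    rw [eq_div_iff (hz j), hD, hD, ← map_mul]
    congr 1
    ext w
    simpa [u, v, mul_comm] using (((hf j) w).hasDerivAt.cexp.deriv).symm
  have hi₀ : D (y ⟨0, hn⟩) ≠ 0 := by
    rw [hD, map_ne_zero_iff _ hinj]
    exact fun h => hQ.ne_zero ⟨0, hn⟩ (funext (hconst _ h))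
  have hval : Sum.elim f (fun j => fun z : ℂ => Complex.exp (f j z)) =
      entire.val ∘ Sum.elim u v := by
    ext (j | j) <;> rfl
  have hxK : Sum.elim y z = IsScalarTower.toAlgHom ℂ entire K ∘ Sum.elim u v := by
    ext (j | j) <;> rfl
  rcases exists_algebraicIndepOn_card_or (R := ℂ) (Sum.elim y z) n with
    ⟨s, hs, hind⟩ | ⟨s, hs, halg⟩
  · refine ⟨s, hs, ?_⟩
    rw [hxK] at hind
    rw [hval]
    have h1 := ((IsScalarTower.toAlgHom ℂ entire K).algebraicIndependent_iff hinj).mp hind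
    exact (entire.val.algebraicIndependent_iff Subtype.val_injective).mpr h1
  · exfalso
    let : Fintype (Sum.elim y z '' s) := (s.finite_toSet.image _).fintype
    have hcard : Fintype.card (Sum.elim y z '' s) ≤ Fintype.card (Fin n) := by
      rw [Fintype.card_fin, ← Set.toFinset_card, Set.toFinset_image, Finset.toFinset_coe]
      exact Finset.card_image_le.trans hs
    obtain ⟨m, hm0, hm⟩ := exists_int_relation D hDc hz hyz hi₀ hcard (fun j => halg (.inl j))
      (fun j => halg (.inr j))
    apply hm0
    have h0 : entireDeriv (∑ j, m j • u j) = 0 := by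
      apply hinj
      rw [map_zero, ← hD]
      simpa [zsmul_eq_mul] using hm
    have h1 : ∑ j, (m j : ℚ) • (fun w => f j w - f j 0) = 0 := by
      ext w
      have h2 (w) : ((∑ j, m j • u j : entire) : ℂ → ℂ) w = ∑ j, m j * f j w := by
        simp [AddSubmonoidClass.coe_finsetSum, u]
      have := hconst _ h0 w
      rw [h2, h2, ← Finset.sum_sub_distrib] at this
      simpa [mul_sub, Rat.smul_def] using this
    ext j
    exact_mod_cast Fintype.linearIndependent_iff.mp hQ _ h1 j

end AxSchanuel

end

/-- **Analytic Ax–Schanuel theorem for the algebraic torus `(ℂ*)^n`.**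
If `f 1, …, f n` are entire functions such that the functions `z ↦ f j z - f j 0`
are linearly independent over `ℚ`, then among the `2n` entire functions
`f 1, …, f n, exp ∘ f 1, …, exp ∘ f n` there are `n + 1` that are algebraically
independent over `ℂ`. -/
theorem analytic_ax_schanuel_torus (n : ℕ) (hn : 1 ≤ n)
    (f : Fin n → ℂ → ℂ) (hf : ∀ j, Differentiable ℂ (f j))
    (hQ : LinearIndependent ℚ (fun j : Fin n => fun z : ℂ => f j z - f j 0)) :
    ∃ s : Finset (Fin n ⊕ Fin n), s.card = n + 1 ∧
      AlgebraicIndependent ℂ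
        (fun i : s => Sum.elim f (fun j => fun z : ℂ => Complex.exp (f j z)) (i : Fin n ⊕ Fin n)) := by
  have : IsScalarTower ℂ AxSchanuel.entire (FractionRing AxSchanuel.entire) := inferInstance
  have : IsScalarTower ℂ AxSchanuel.entire (AlgebraicClosure (FractionRing AxSchanuel.entire)) :=
    AlgebraicClosure.instIsScalarTower _
  have : IsScalarTower AxSchanuel.entire (FractionRing AxSchanuel.entire)
      (AlgebraicClosure (FractionRing AxSchanuel.entire)) :=
    AlgebraicClosure.instIsScalarTower _
  exact AxSchanuel.exists_algebraicIndependent (FractionRing AxSchanuel.entire)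
    (AlgebraicClosure (FractionRing AxSchanuel.entire)) hn hf hQ
end

section
/- Let n ≥ 1 and let f_1, …, f_n be entire functions such that the n functions z ↦ f_j(z) − f_j(0) (1 ≤ j ≤ n) are linearly independent over ℚ. Let m be the largest cardinality of a subset of {f_1, …, f_n} that is algebraically independent over ℂ. Then there exists a subset of the 2n functions {f_1, …, f_n, e^{f_1}, …, e^{f_n}} of cardinality m+1 that is algebraically independent over ℂ. (In other words, the transcendence degree over ℂ(f_1,…,f_n) of the field obtained by adjoining e^{f_1}, …, e^{f_n} is at least 1.) -/
open Complex

/-- A monotone function whose growth is controlled by its own logarithm on every larger radius is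
bounded: otherwise it would blow up at a finite radius. -/
theorem exists_forall_le_of_le_mul_log {G : ℝ → ℝ} {K : ℝ} (hK : 0 < K)
    (hmono : MonotoneOn G (Set.Ioi 0)) (hone : ∀ r, 0 < r → 1 ≤ G r)
    (hG : ∀ r R, 0 < r → r < R → G r ≤ K * (R / (R - r)) ^ 2 * (1 + Real.log (G R))) :
    ∃ B, ∀ r, 0 < r → G r ≤ B := by
  set L : ℝ := 1024 * K ^ 2 with hL
  have hLpos : 0 < L := by positivity
  refine ⟨16 * L, fun r₀ hr₀ ↦ ?_⟩
  by_contra! hlt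
  set ρ : ℕ → ℝ := fun k ↦ r₀ * (2 - (1 / 2) ^ k) with hρ
  have hle (k : ℕ) : ((1 : ℝ) / 2) ^ k ≤ 1 := pow_le_one₀ (by norm_num) (by norm_num)
  have hpos (k : ℕ) : (0 : ℝ) < (1 / 2) ^ k := by positivity
  have hρpos (k : ℕ) : 0 < ρ k := mul_pos hr₀ (by linarith [hle k])
  have hstep (k : ℕ) : G (ρ k) ^ 2 ≤ L * 16 ^ k * G (ρ (k + 1)) := by
    have hsub : ρ (k + 1) - ρ k = r₀ * (1 / 2) ^ (k + 1) := by simp only [hρ]; ring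
    have hsub_pos : 0 < ρ (k + 1) - ρ k := by rw [hsub]; positivity
    have hq : ρ (k + 1) / (ρ (k + 1) - ρ k) ≤ 2 ^ (k + 2) := by
      rw [div_le_iff₀ hsub_pos, hsub]
      have : (2 : ℝ) ^ (k + 2) * (r₀ * (1 / 2) ^ (k + 1)) = r₀ * 2 := by
        have : (2 : ℝ) ^ k * (1 / 2) ^ k = 1 := by rw [← mul_pow]; norm_num
        linear_combination (2 * r₀) * this
      rw [this]
      exact mul_le_mul_of_nonneg_left (by linarith [hpos (k + 1)]) hr₀.le
    have hq0 : 0 ≤ ρ (k + 1) / (ρ (k + 1) - ρ k) := (div_pos (hρpos _) hsub_pos).le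
    set s := √(G (ρ (k + 1))) with hs
    have hs1 : 1 ≤ s := Real.one_le_sqrt.2 (hone _ (hρpos _))
    have hss : s ^ 2 = G (ρ (k + 1)) := Real.sq_sqrt (by linarith [hone (ρ (k + 1)) (hρpos _)])
    have hlog : 1 + Real.log (G (ρ (k + 1))) ≤ 2 * s := by
      rw [← hss, Real.log_pow]
      have := Real.log_le_sub_one_of_pos (by linarith : 0 < s)
      push_cast; linarith
    have hlog0 : 0 ≤ 1 + Real.log (G (ρ (k + 1))) := by
      linarith [Real.log_nonneg (hone (ρ (k + 1)) (hρpos _))]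
    calc G (ρ k) ^ 2 ≤ (K * (2 ^ (k + 2)) ^ 2 * (2 * s)) ^ 2 := by
          have h0 : 0 ≤ G (ρ k) := by linarith [hone (ρ k) (hρpos _)]
          gcongr
          refine (hG (ρ k) (ρ (k + 1)) (hρpos k) (by linarith)).trans ?_
          gcongr
      _ = L * 16 ^ k * G (ρ (k + 1)) := by
          have h16 : (16 : ℝ) ^ k = (2 ^ k) ^ 4 := by
            rw [← pow_mul, mul_comm, pow_mul]; norm_num
          rw [← hss, hL, h16]
          ring
  have hgrow (k : ℕ) : 16 * L * 16 ^ k ≤ G (ρ k) := by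
    induction k with
    | zero => simpa [hρ, show r₀ * (2 - 1) = r₀ by ring] using hlt.le
    | succ k ih =>
      have h16 : 0 < L * 16 ^ k := by positivity
      have h1 : (16 * L * 16 ^ k) ^ 2 ≤ G (ρ k) ^ 2 := by gcongr
      have h2 := h1.trans (hstep k)
      refine le_of_mul_le_mul_left ?_ h16
      refine le_trans (le_of_eq ?_) h2
      ring
  obtain ⟨k, hk⟩ := pow_unbounded_of_one_lt (G (r₀ * 2) / (16 * L)) (by norm_num : (1 : ℝ) < 16)
  rw [div_lt_iff₀ (by positivity)] at hk
  have : G (ρ k) ≤ G (r₀ * 2) := hmono (hρpos k) (by simpa using hr₀) (by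
    exact mul_le_mul_of_nonneg_left (by linarith [hpos k]) hr₀.le)
  linarith [hgrow k]

/-- An entire function is bounded on a disc by the mean of the absolute value of its real part on a
larger circle, by the Poisson formula and the Borel–Carathéodory theorem. -/
theorem norm_le_of_circleAverage_abs_re_le {f : ℂ → ℂ} (hf : Differentiable ℂ f) {r R A : ℝ}
    (hr : 0 < r) (hrR : r < R) (hA : 0 < A)
    (hfA : Real.circleAverage (fun z ↦ |(f z).re|) 0 R ≤ A) {z : ℂ} (hz : ‖z‖ ≤ r) :
    ‖f z‖ ≤ (R / (R - r)) ^ 2 * (16 * A + 4 * ‖f 0‖) := by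
  have hR : 0 < R := hr.trans hrR
  set q := R / (R - r) with hq
  have hq1 : 1 ≤ q := (one_le_div (by linarith)).2 (by linarith)
  have hqR : R = q * (R - r) := by rw [hq, div_mul_cancel₀ _ (by linarith)]
  set ρ := (r + R) / 2 with hρ
  have hre : Set.MapsTo f (Metric.ball 0 ρ) {w | w.re ≤ 4 * q * A} := by
    intro w hw
    have hwρ : ‖w‖ < ρ := by simpa using hw
    have hwR : w ∈ Metric.ball (0 : ℂ) R := by simp; linarith
    have hharm : InnerProductSpace.HarmonicOnNhd (fun z ↦ (f z).re) (Metric.closedBall 0 R) :=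
      fun x _ ↦ (hf.analyticAt x).harmonicAt_re
    have hP := hharm.circleAverage_re_herglotzRieszKernel_smul hwR
    change (f w).re ≤ 4 * q * A
    rw [← hP]
    have hker (x : ℂ) (hx : x ∈ Metric.sphere 0 |R|) :
        0 ≤ (herglotzRieszKernel 0 w x).re ∧ (herglotzRieszKernel 0 w x).re ≤ 4 * q := by
      rw [abs_of_pos hR] at hx
      have h1 := re_herglotzRieszKernel_le hx hwR
      have h2 := le_re_herglotzRieszKernel hx hwR
      rw [← herglotzRieszKernel_def] at h1 h2
      rw [sub_zero] at h1 h2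
      refine ⟨le_trans (div_nonneg (by linarith) (by linarith [norm_nonneg w])) h2, h1.trans ?_⟩
      rw [div_le_iff₀ (by linarith)]
      nlinarith
    have hcf : Continuous fun z ↦ (f z).re := continuous_re.comp hf.continuous
    calc _ ≤ Real.circleAverage ((4 * q) • fun z ↦ |(f z).re|) 0 R := by
          refine Real.circleAverage_mono ?_ ?_ ?_
          · refine ContinuousOn.circleIntegrable' ?_
            exact (continuous_re.comp_continuousOn (continuousOn_herglotzRieszKernel_sphere hwR)).smul
              hcf.continuousOn
          · exact (Continuous.continuousOn (by fun_prop)).circleIntegrable'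
          · intro x hx
            obtain ⟨h0, h1⟩ := hker x hx
            simp only [Pi.smul_apply', Function.comp_apply, Pi.smul_apply, smul_eq_mul]
            exact (mul_le_mul_of_nonneg_left (le_abs_self _) h0).trans
              (mul_le_mul_of_nonneg_right h1 (abs_nonneg _))
      _ = 4 * q * Real.circleAverage (fun z ↦ |(f z).re|) 0 R := by
          rw [Real.circleAverage_smul, smul_eq_mul]
      _ ≤ 4 * q * A := by gcongr
  have hBC := borelCaratheodory (z := z) (by positivity : 0 < 4 * q * A) hf.differentiableOn hre
    (by positivity) (by simp; linarith)
  have hd : 0 < ρ - ‖z‖ := by linarith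
  have h1 : ‖z‖ / (ρ - ‖z‖) ≤ 2 * q := by
    rw [div_le_iff₀ hd]; nlinarith
  have h2 : (ρ + ‖z‖) / (ρ - ‖z‖) ≤ 4 * q := by
    rw [div_le_iff₀ hd]; nlinarith
  calc ‖f z‖ ≤ 2 * (4 * q * A) * (‖z‖ / (ρ - ‖z‖)) + ‖f 0‖ * ((ρ + ‖z‖) / (ρ - ‖z‖)) := by
        simpa only [mul_div_assoc] using hBC
    _ ≤ 2 * (4 * q * A) * (2 * q) + ‖f 0‖ * (4 * q) := by gcongr
    _ ≤ q ^ 2 * (16 * A + 4 * ‖f 0‖) := by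
        nlinarith [mul_nonneg (norm_nonneg (f 0)) (by nlinarith : 0 ≤ q ^ 2 - q)]

theorem log_norm_le_circleAverage {h : ℂ → ℂ} (hh : Differentiable ℂ h) (h0 : h 0 ≠ 0) {R : ℝ}
    (hR : 0 < R) : Real.log ‖h 0‖ ≤ Real.circleAverage (Real.log ‖h ·‖) 0 R := by
  have han : AnalyticOnNhd ℂ h (Metric.closedBall 0 |R|) := fun z _ ↦ hh.analyticAt z
  rw [han.circleAverage_log_norm hR.ne' h0]
  refine le_add_of_nonneg_left (finsum_nonneg fun u ↦ ?_)
  by_cases hu : u ∈ Metric.closedBall (0 : ℂ) |R|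
  · refine mul_nonneg (mod_cast MeromorphicOn.AnalyticOnNhd.divisor_nonneg han _) ?_
    rcases eq_or_ne u 0 with rfl | hu0
    · simp
    · refine Real.log_nonneg ?_
      rw [zero_sub, norm_neg, ← div_eq_mul_inv, one_le_div (norm_pos_iff.2 hu0)]
      simpa [abs_of_pos hR] using hu
  · simp [Function.locallyFinsuppWithin.apply_eq_zero_of_notMem _ hu]

theorem circleAverage_abs_re_le {f g h : ℂ → ℂ} (hf : Differentiable ℂ f)
    (hg : Differentiable ℂ g) (hh : Differentiable ℂ h) (hgh : ∀ z, g z = h z * exp (f z))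
    (h0 : h 0 ≠ 0) {R B : ℝ} (hR : 0 < R)
    (hgB : ∀ z ∈ Metric.sphere (0 : ℂ) R, Real.log ‖g z‖ ≤ B)
    (hhB : ∀ z ∈ Metric.sphere (0 : ℂ) R, Real.log ‖h z‖ ≤ B) :
    Real.circleAverage (fun z ↦ |(f z).re|) 0 R ≤
      2 * B - Real.log ‖g 0‖ - Real.log ‖h 0‖ := by
  have g0 : g 0 ≠ 0 := by rw [hgh]; exact mul_ne_zero h0 (exp_ne_zero _)
  have hgi : CircleIntegrable (Real.log ‖g ·‖) 0 R :=
    MeromorphicOn.circleIntegrable_log_norm fun z _ ↦ (hg.analyticAt z).meromorphicAt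
  have hhi : CircleIntegrable (Real.log ‖h ·‖) 0 R :=
    MeromorphicOn.circleIntegrable_log_norm fun z _ ↦ (hh.analyticAt z).meromorphicAt
  have hne : ∀ᶠ z in Filter.codiscreteWithin (Metric.sphere (0 : ℂ) |R|), h z ≠ 0 := by
    have han : AnalyticOnNhd ℂ h Set.univ := fun z _ ↦ hh.analyticAt z
    rcases han.eqOn_zero_or_eventually_ne_zero_of_preconnected isPreconnected_univ with h1 | h1
    · exact absurd (h1 (Set.mem_univ 0)) h0
    · exact Filter.codiscreteWithin_mono (Set.subset_univ _) h1
  set u : ℂ → ℝ := fun z ↦ 2 * B - Real.log ‖g z‖ - Real.log ‖h z‖ with hu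
  have hui : CircleIntegrable u 0 R :=
    ((circleIntegrable_const (2 * B) 0 R).sub hgi).sub hhi
  have huv : u =ᶠ[Filter.codiscreteWithin (Metric.sphere (0 : ℂ) |R|)]
      fun z ↦ max (u z) |(f z).re| := by
    filter_upwards [hne, Filter.self_mem_codiscreteWithin _] with z hz hzR
    rw [abs_of_pos hR] at hzR
    refine (max_eq_left ?_).symm
    have hre : Real.log ‖g z‖ = Real.log ‖h z‖ + (f z).re := by
      rw [hgh, norm_mul, Real.log_mul (norm_ne_zero_iff.2 hz) (norm_ne_zero_iff.2 (exp_ne_zero _)),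
        norm_exp, Real.log_exp]
    have h1 := hgB z hzR
    have h2 := hhB z hzR
    rw [abs_le]
    constructor <;> simp only [hu] <;> linarith
  calc _ ≤ Real.circleAverage (fun z ↦ max (u z) |(f z).re|) 0 R := by
        refine Real.circleAverage_mono ?_ (hui.congr_codiscreteWithin huv) fun z _ ↦ le_max_right _ _
        have := hf.continuous
        exact (Continuous.continuousOn (by fun_prop)).circleIntegrable'
    _ = Real.circleAverage u 0 R := (Real.circleAverage_congr_codiscreteWithin huv hR.ne').symm
    _ = 2 * B - Real.circleAverage (Real.log ‖g ·‖) 0 R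
        - Real.circleAverage (Real.log ‖h ·‖) 0 R := by
      rw [show u = ((fun _ ↦ 2 * B) - (Real.log ‖g ·‖)) - (Real.log ‖h ·‖) from rfl,
        Real.circleAverage_sub ((circleIntegrable_const (2 * B) 0 R).sub hgi) hhi,
        Real.circleAverage_sub (circleIntegrable_const (2 * B) 0 R) hgi,
        Real.circleAverage_const]
    _ ≤ _ := by
      linarith [log_norm_le_circleAverage hg g0 hR, log_norm_le_circleAverage hh h0 hR]

/-- `u` is bounded everywhere by a constant multiple of some power of `Φ`. -/
def IsPolyBounded {E : Type*} [Norm E] (Φ : ℂ → ℝ) (u : ℂ → E) : Prop :=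
  ∃ N : ℕ, u =O[⊤] fun z ↦ Φ z ^ N

namespace IsPolyBounded

open Asymptotics

variable {Φ : ℂ → ℝ}

theorem add {E : Type*} [SeminormedAddCommGroup E] {u v : ℂ → E} (hΦ : ∀ z, 1 ≤ Φ z)
    (hu : IsPolyBounded Φ u) (hv : IsPolyBounded Φ v) :
    IsPolyBounded Φ fun z ↦ u z + v z := by
  obtain ⟨M, hM⟩ := hu
  obtain ⟨N, hN⟩ := hv
  have hpow {m n : ℕ} (hmn : m ≤ n) : (fun z ↦ Φ z ^ m) =O[⊤] fun z ↦ Φ z ^ n := by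
    refine .of_bound 1 (Filter.Eventually.of_forall fun z ↦ ?_)
    have h0 : 0 ≤ Φ z := zero_le_one.trans (hΦ z)
    rw [one_mul, Real.norm_of_nonneg (by positivity), Real.norm_of_nonneg (by positivity)]
    exact pow_le_pow_right₀ (hΦ z) hmn
  exact ⟨max M N, (hM.trans (hpow (le_max_left _ _))).add (hN.trans (hpow (le_max_right _ _)))⟩

theorem mul {u v : ℂ → ℂ} (hu : IsPolyBounded Φ u) (hv : IsPolyBounded Φ v) :
    IsPolyBounded Φ fun z ↦ u z * v z := by
  obtain ⟨M, hM⟩ := hu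
  obtain ⟨N, hN⟩ := hv
  exact ⟨M + N, by simpa only [pow_add] using hM.mul hN⟩

theorem const {E : Type*} [SeminormedAddCommGroup E] (c : E) : IsPolyBounded Φ fun _ ↦ c :=
  ⟨0, by simpa using isBigO_const_const c (one_ne_zero (α := ℝ)) ⊤⟩

theorem sum {ι E : Type*} [SeminormedAddCommGroup E] (hΦ : ∀ z, 1 ≤ Φ z) {s : Finset ι}
    {u : ι → ℂ → E} (hu : ∀ i ∈ s, IsPolyBounded Φ (u i)) :
    IsPolyBounded Φ fun z ↦ ∑ i ∈ s, u i z := by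
  classical
  induction s using Finset.induction_on with
  | empty => simpa using const (0 : E)
  | insert i s hi ih =>
    simp only [Finset.sum_insert hi]
    exact (hu i (by simp)).add hΦ (ih fun j hj ↦ hu j (by simp [hj]))

theorem of_norm_le {E F : Type*} [Norm E] [SeminormedAddCommGroup F] {u : ℂ → E} {v : ℂ → F}
    (hv : IsPolyBounded Φ v) (huv : ∀ z, ‖u z‖ ≤ ‖v z‖) : IsPolyBounded Φ u := by
  obtain ⟨N, hN⟩ := hv
  exact ⟨N, (IsBigO.of_bound 1 (Filter.Eventually.of_forall fun z ↦ by simpa using huv z)).trans hN⟩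

theorem exists_log_norm_le {E : Type*} [SeminormedAddCommGroup E] {u : ℂ → E} (hΦ : ∀ z, 1 ≤ Φ z)
    (hu : IsPolyBounded Φ u) :
    ∃ D, 0 ≤ D ∧ ∀ z S, Φ z ≤ S → Real.log ‖u z‖ ≤ D * (1 + Real.log S) := by
  obtain ⟨N, hN⟩ := hu
  obtain ⟨C, hC, hb⟩ := hN.exists_nonneg
  rw [isBigOWith_top] at hb
  refine ⟨C + N, by positivity, fun z S hS ↦ ?_⟩
  have hS1 : 1 ≤ S := (hΦ z).trans hS
  have hlS : 0 ≤ Real.log S := Real.log_nonneg hS1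
  rcases (norm_nonneg (u z)).eq_or_lt' with h0 | hpos
  · rw [h0, Real.log_zero]; positivity
  have hle : ‖u z‖ ≤ C * S ^ N := by
    refine (hb z).trans ?_
    rw [norm_pow, Real.norm_of_nonneg (zero_le_one.trans (hΦ z))]
    have := zero_le_one.trans (hΦ z)
    gcongr
  have hCpos : 0 < C := by
    by_contra! hC0
    have : C = 0 := le_antisymm hC0 hC
    simp [this] at hle
    linarith
  have h1 : Real.log ‖u z‖ ≤ Real.log C + N * Real.log S := by
    rw [← Real.log_pow, ← Real.log_mul hCpos.ne' (by positivity)]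
    exact Real.log_le_log hpos hle
  have h2 : Real.log C ≤ C := Real.log_le_self hC
  have h3 : 0 ≤ C * Real.log S := by positivity
  have h4 : (0 : ℝ) ≤ N := by positivity
  linarith

/-- Functions integral over a ring of polynomially bounded functions are polynomially bounded. -/
theorem of_isIntegral (hΦ : ∀ z, 1 ≤ Φ z) {A : Subalgebra ℂ (ℂ → ℂ)}
    (hA : ∀ a ∈ A, IsPolyBounded Φ a) {g : ℂ → ℂ} (hg : IsIntegral A g) : IsPolyBounded Φ g := by
  obtain ⟨p, hp, hpg⟩ := hg
  have hsum : IsPolyBounded Φ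
      fun z ↦ (∑ i ∈ Finset.range p.natDegree, ‖(p.coeff i : ℂ → ℂ) z‖) + 1 := by
    refine (sum hΦ fun i _ ↦ ?_).add hΦ (const 1)
    exact (hA _ (p.coeff i).2).of_norm_le fun z ↦ by simp
  refine hsum.of_norm_le fun z ↦ ?_
  set ev : A →+* ℂ := (Pi.evalRingHom (fun _ : ℂ ↦ ℂ) z).comp (algebraMap A (ℂ → ℂ)) with hev
  have hroot : (p.map ev).IsRoot (g z) := by
    rw [Polynomial.IsRoot, Polynomial.eval_map, hev]
    have := congrArg (Pi.evalRingHom (fun _ : ℂ ↦ ℂ) z) hpg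
    rwa [Polynomial.hom_eval₂, map_zero] at this
  have hm : (p.map ev).Monic := hp.map ev
  have hlt := hroot.norm_lt_cauchyBound hm.ne_zero
  rw [Real.norm_of_nonneg (by positivity)]
  refine (NNReal.coe_le_coe.2 hlt.le).trans ?_
  rw [Polynomial.cauchyBound, hm.leadingCoeff, hp.natDegree_map]
  have : (Finset.range p.natDegree).sup (fun i ↦ ‖(p.map ev).coeff i‖₊) ≤
      ∑ i ∈ Finset.range p.natDegree, ‖(p.map ev).coeff i‖₊ :=
    Finset.sup_le fun i hi ↦ Finset.single_le_sum (f := fun i ↦ ‖(p.map ev).coeff i‖₊)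
      (fun _ _ ↦ zero_le) hi
  have := NNReal.coe_le_coe.2 this
  push_cast at this
  simpa [hev] using this

end IsPolyBounded

/-- The algebra of entire functions bounded by a constant multiple of a power of `Φ`. -/
def entirePolyBounded (Φ : ℂ → ℝ) (hΦ : ∀ z, 1 ≤ Φ z) : Subalgebra ℂ (ℂ → ℂ) where
  carrier := {u | Differentiable ℂ u ∧ IsPolyBounded Φ u}
  mul_mem' hu hv := ⟨hu.1.mul hv.1, hu.2.mul hv.2⟩
  add_mem' hu hv := ⟨hu.1.add hv.1, hu.2.add hΦ hv.2⟩
  algebraMap_mem' c := ⟨differentiable_const c, .const c⟩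

/-- If `e ^ f` is a quotient of polynomially bounded entire functions, then `f` is bounded on any
disc by a multiple of the logarithm of a bound of `Φ` on a larger circle. -/
theorem exists_norm_le_mul_log {Φ : ℂ → ℝ} (hΦ : ∀ z, 1 ≤ Φ z) {f g h : ℂ → ℂ}
    (hf : Differentiable ℂ f) (hg : Differentiable ℂ g) (hh : Differentiable ℂ h)
    (hgh : ∀ z, g z = h z * exp (f z)) (h0 : h 0 ≠ 0)
    (hgΦ : IsPolyBounded Φ g) (hhΦ : IsPolyBounded Φ h) :
    ∃ K, 0 ≤ K ∧ ∀ r R S, 0 < r → r < R → 1 ≤ S → (∀ z ∈ Metric.sphere (0 : ℂ) R, Φ z ≤ S) →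
      ∀ z, ‖z‖ ≤ r → ‖f z‖ ≤ K * ((R / (R - r)) ^ 2 * (1 + Real.log S)) := by
  obtain ⟨D₁, hD₁, hb₁⟩ := hgΦ.exists_log_norm_le hΦ
  obtain ⟨D₂, hD₂, hb₂⟩ := hhΦ.exists_log_norm_le hΦ
  set E := 1 + |Real.log ‖g 0‖| + |Real.log ‖h 0‖| with hE
  refine ⟨16 * (2 * (D₁ + D₂) + E) + 4 * ‖f 0‖, by positivity,
    fun r R S hr hrR hS hΦS z hz ↦ ?_⟩
  have hlS : 0 ≤ Real.log S := Real.log_nonneg hS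
  have havg := circleAverage_abs_re_le (B := (D₁ + D₂) * (1 + Real.log S)) hf hg hh hgh h0
    (hr.trans hrR)
    (fun z hz ↦ (hb₁ z S (hΦS z hz)).trans (by gcongr; linarith))
    (fun z hz ↦ (hb₂ z S (hΦS z hz)).trans (by gcongr; linarith))
  have hA : 2 * ((D₁ + D₂) * (1 + Real.log S)) - Real.log ‖g 0‖ - Real.log ‖h 0‖ ≤
      (2 * (D₁ + D₂) + E) * (1 + Real.log S) := by
    have : 0 ≤ E * Real.log S := by positivity
    have := neg_abs_le (Real.log ‖g 0‖)
    have := neg_abs_le (Real.log ‖h 0‖)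
    linarith
  refine (norm_le_of_circleAverage_abs_re_le hf hr hrR (by positivity) (havg.trans hA) hz).trans ?_
  rw [mul_left_comm _ ((R / (R - r)) ^ 2)]
  refine mul_le_mul_of_nonneg_left ?_ (sq_nonneg _)
  have : 0 ≤ ‖f 0‖ * Real.log S := by positivity
  linarith

/-- Entire functions `f i` whose exponentials are all quotients of entire functions of at most
polynomial growth in the `f i` are bounded. -/
theorem exists_forall_norm_le_of_exp_quotient {ι : Type*} [Fintype ι] {f g h : ι → ℂ → ℂ}
    (hf : ∀ i, Differentiable ℂ (f i)) (hg : ∀ i, Differentiable ℂ (g i))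
    (hh : ∀ i, Differentiable ℂ (h i)) (hgh : ∀ i z, g i z = h i z * exp (f i z))
    (h0 : ∀ i, h i 0 ≠ 0) (hgΦ : ∀ i, IsPolyBounded (fun z ↦ 1 + ∑ j, ‖f j z‖) (g i))
    (hhΦ : ∀ i, IsPolyBounded (fun z ↦ 1 + ∑ j, ‖f j z‖) (h i)) :
    ∃ B, ∀ i z, ‖f i z‖ ≤ B := by
  set Φ : ℂ → ℝ := fun z ↦ 1 + ∑ j, ‖f j z‖ with hΦdef
  have hΦ (z : ℂ) : 1 ≤ Φ z := le_add_of_nonneg_right (by positivity)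
  have hΦc : Continuous Φ := by
    have := fun i ↦ (hf i).continuous
    fun_prop
  choose K hK0 hK using fun i ↦ exists_norm_le_mul_log hΦ (hf i) (hg i) (hh i) (hgh i) (h0 i)
    (hgΦ i) (hhΦ i)
  set G : ℝ → ℝ := fun r ↦ sSup (Φ '' Metric.closedBall 0 r) with hG
  have hbdd (r : ℝ) : BddAbove (Φ '' Metric.closedBall 0 r) :=
    (isCompact_closedBall 0 r).bddAbove_image hΦc.continuousOn
  have hle {r : ℝ} {z : ℂ} (hz : ‖z‖ ≤ r) : Φ z ≤ G r :=
    le_csSup (hbdd r) ⟨z, by simpa using hz, rfl⟩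
  have hGle {r S : ℝ} (hr : 0 < r) (hS : ∀ z : ℂ, ‖z‖ ≤ r → Φ z ≤ S) : G r ≤ S := by
    refine csSup_le ⟨Φ 0, 0, by simpa using hr.le, rfl⟩ ?_
    rintro _ ⟨z, hz, rfl⟩
    exact hS z (by simpa using hz)
  have hone (r : ℝ) (hr : 0 < r) : 1 ≤ G r := (hΦ 0).trans (hle (by simpa using hr.le))
  have hKs : 0 ≤ ∑ i, K i := Finset.sum_nonneg fun i _ ↦ hK0 i
  obtain ⟨B, hB⟩ := exists_forall_le_of_le_mul_log (G := G) (K := 1 + ∑ i, K i) (by positivity)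
    (fun r hr R _ hrR ↦ hGle hr fun z hz ↦ hle (hz.trans hrR)) hone
    (fun r R hr hrR ↦ hGle hr fun z hz ↦ by
      have hlog := Real.log_nonneg (hone R (hr.trans hrR))
      have hq : 1 ≤ R / (R - r) := (one_le_div (by linarith)).2 (by linarith)
      have hX : 1 ≤ (R / (R - r)) ^ 2 * (1 + Real.log (G R)) :=
        one_le_mul_of_one_le_of_one_le (one_le_pow₀ hq) (by linarith)
      have hsum : ∑ i, ‖f i z‖ ≤
          (∑ i, K i) * ((R / (R - r)) ^ 2 * (1 + Real.log (G R))) := by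
        rw [Finset.sum_mul]
        exact Finset.sum_le_sum fun i _ ↦ hK i r R (G R) hr hrR (hone R (hr.trans hrR))
          (fun w hw ↦ hle (by simpa using hw.le)) z hz
      simp only [hΦdef]
      linarith)
  refine ⟨B, fun i z ↦ ?_⟩
  calc ‖f i z‖ ≤ ∑ j, ‖f j z‖ := Finset.single_le_sum (f := fun j ↦ ‖f j z‖)
        (fun _ _ ↦ norm_nonneg _) (Finset.mem_univ i)
    _ ≤ Φ z := by simp [hΦdef]
    _ ≤ G (‖z‖ + 1) := hle (by linarith)
    _ ≤ B := hB _ (by positivity)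

theorem exists_forall_apply_ne_zero {ι : Type*} [Finite ι] {h : ι → ℂ → ℂ}
    (hh : ∀ i, Differentiable ℂ (h i)) (hne : ∀ i, h i ≠ 0) : ∃ c, ∀ i, h i c ≠ 0 := by
  have (i : ι) : ∀ᶠ z in Filter.codiscreteWithin (Set.univ : Set ℂ), h i z ≠ 0 := by
    have han : AnalyticOnNhd ℂ (h i) Set.univ := fun z _ ↦ (hh i).analyticAt z
    rcases han.eqOn_zero_or_eventually_ne_zero_of_preconnected isPreconnected_univ with h1 | h1
    · exact absurd (funext fun z ↦ h1 (Set.mem_univ z)) (hne i)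
    · exact h1
  have hall := Filter.eventually_all.2 this
  have : ∀ᶠ z in nhdsWithin (0 : ℂ) {0}ᶜ, ∀ i, h i z ≠ 0 :=
    Filter.Eventually.filter_mono (by
      simpa [Filter.codiscreteWithin, Set.compl_eq_univ_sdiff] using
        le_iSup (fun x : ℂ ↦ nhdsWithin x {x}ᶜ) 0) hall
  exact this.exists

/-- If one of finitely many entire functions `f i` is not constant, then some `e ^ f i` is
transcendental over the algebra generated by any subfamily of the `f i`. -/
theorem exists_transcendental_exp {ι : Type*} [Finite ι] {f : ι → ℂ → ℂ}
    (hf : ∀ i, Differentiable ℂ (f i)) {j : ι} (hj : ¬ ∃ c, ∀ z, f j z = c) (s : Set ι) :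
    ∃ i, Transcendental (Algebra.adjoin ℂ (f '' s)) fun z ↦ exp (f i z) := by
  have := Fintype.ofFinite ι
  by_contra! hall
  simp only [Transcendental, not_not] at hall
  set Φ : ℂ → ℝ := fun z ↦ 1 + ∑ j, ‖f j z‖ with hΦdef
  have hΦ (z : ℂ) : 1 ≤ Φ z := le_add_of_nonneg_right (by positivity)
  have hA : Algebra.adjoin ℂ (f '' s) ≤ entirePolyBounded Φ hΦ := by
    refine Algebra.adjoin_le ?_
    rintro _ ⟨i, -, rfl⟩
    refine ⟨hf i, 1, .of_bound 1 (Filter.Eventually.of_forall fun z ↦ ?_)⟩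
    rw [one_mul, pow_one, Real.norm_of_nonneg (zero_le_one.trans (hΦ z))]
    have := Finset.single_le_sum (f := fun j ↦ ‖f j z‖) (fun _ _ ↦ norm_nonneg _)
      (Finset.mem_univ i)
    simp only [hΦdef]
    linarith
  choose y hy0 hy using fun i ↦ (hall i).exists_integral_multiple
  have hydiff (i : ι) : Differentiable ℂ (y i : ℂ → ℂ) := (hA (y i).2).1
  have hypoly (i : ι) : IsPolyBounded Φ (y i : ℂ → ℂ) := (hA (y i).2).2
  obtain ⟨c, hc⟩ := exists_forall_apply_ne_zero hydiff fun i ↦ by simpa using hy0 i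
  have htrans {E : Type} [Norm E] {u : ℂ → E} (hu : IsPolyBounded Φ u) :
      IsPolyBounded (fun z ↦ 1 + ∑ j, ‖f j (z + c)‖) fun z ↦ u (z + c) := by
    obtain ⟨N, hN⟩ := hu
    exact ⟨N, hN.comp_tendsto (k := fun z ↦ z + c) Filter.tendsto_top⟩
  obtain ⟨B, hB⟩ := exists_forall_norm_le_of_exp_quotient (f := fun i z ↦ f i (z + c))
    (g := fun i z ↦ (y i : ℂ → ℂ) (z + c) * exp (f i (z + c)))
    (h := fun i z ↦ (y i : ℂ → ℂ) (z + c)) (fun i ↦ by have := hf i; fun_prop)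
    (fun i ↦ by have := hf i; have := hydiff i; fun_prop)
    (fun i ↦ by have := hydiff i; fun_prop) (fun _ _ ↦ rfl) (fun i ↦ by simpa using hc i)
    (fun i ↦ htrans (.of_isIntegral hΦ (fun a ha ↦ (hA ha).2) (hy i)))
    (fun i ↦ htrans (hypoly i))
  refine hj ⟨f j 0, fun z ↦ (hf j).apply_eq_apply_of_bounded ?_ z 0⟩
  refine isBounded_iff_forall_norm_le.2 ⟨B, ?_⟩
  rintro _ ⟨z, rfl⟩
  simpa using hB j (z - c)

theorem AlgebraicIndependent.sumElim_insert_inr {R A ι κ : Type*} [DecidableEq ι] [DecidableEq κ]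
    [CommRing R] [CommRing A] [Algebra R A] {f : ι → A} {e : κ → A} {s : Finset ι}
    (hs : AlgebraicIndependent R fun i : s ↦ f i) {k : κ}
    (hk : Transcendental (Algebra.adjoin R (f '' s)) (e k)) :
    AlgebraicIndependent R fun i : (insert (Sum.inr k) (s.map .inl) : Finset (ι ⊕ κ)) ↦
      Sum.elim f e i := by
  have hxs : AlgebraicIndepOn R (Sum.elim f e) (Sum.inl '' (s : Set ι)) := by
    refine (algebraicIndependent_equiv' (Equiv.Set.image (Sum.inl : ι → ι ⊕ κ) s
      Sum.inl_injective) ?_).1 hs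
    funext i
    rw [Function.comp_apply, Equiv.Set.image_apply, Sum.elim_inl]
  have himage : Sum.elim f e '' (Sum.inl '' (s : Set ι)) = f '' s := by
    simp [Set.image_image]
  have hins := hxs.insert (i := Sum.inr k) (by rw [himage]; exact hk)
  have hset : insert (Sum.inr k) (Sum.inl '' (s : Set ι)) =
      ((insert (Sum.inr k) (s.map .inl) : Finset (ι ⊕ κ)) : Set (ι ⊕ κ)) := by
    simp
  rw [hset] at hins
  exact hins

/-- Let `f 1, …, f n` be entire functions such that the functions `z ↦ f j z - f j 0`
are linearly independent over `ℚ`, and let `m` be the largest cardinality of a subset of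
`{f 1, …, f n}` algebraically independent over `ℂ`.  Then some `m + 1` of the `2n`
functions `f 1, …, f n, e^{f 1}, …, e^{f n}` are algebraically independent over `ℂ`. -/
theorem ax_schanuel_torus_relative (n : ℕ) (hn : 1 ≤ n)
    (f : Fin n → ℂ → ℂ) (hf : ∀ j, Differentiable ℂ (f j))
    (hQ : LinearIndependent ℚ (fun j : Fin n => fun z : ℂ => f j z - f j 0))
    (m : ℕ)
    (hm : IsGreatest {k : ℕ | ∃ s : Finset (Fin n), s.card = k ∧
        AlgebraicIndependent ℂ (fun i : s => f i)} m) :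
    ∃ t : Finset (Fin n ⊕ Fin n), t.card = m + 1 ∧
      AlgebraicIndependent ℂ
        (fun i : t => Sum.elim f (fun j => fun z : ℂ => Complex.exp (f j z)) (i : Fin n ⊕ Fin n)) := by
  obtain ⟨⟨s, hs, hind⟩, -⟩ := hm
  have hconst : ¬ ∃ c, ∀ z, f ⟨0, hn⟩ z = c := by
    rintro ⟨c, hc⟩
    exact hQ.ne_zero ⟨0, hn⟩ (funext fun z ↦ by simp [hc])
  obtain ⟨i, hi⟩ := exists_transcendental_exp hf hconst s
  refine ⟨insert (Sum.inr i) (s.map .inl), ?_, hind.sumElim_insert_inr hi⟩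
  rw [Finset.card_insert_of_notMem (by simp), Finset.card_map, hs]
end

section
/- Let n ≥ 1 and let f_1, …, f_n be entire functions such that the n functions z ↦ f_j(z) − f_j(0) (1 ≤ j ≤ n) are linearly independent over ℚ. Then the n entire functions e^{f_1}, …, e^{f_n} are algebraically independent over ℂ. -/
open Complex

/-- Cauchy's estimate for the derivatives of `exp ∘ h`, relative to the value of `exp ∘ h`. -/
theorem norm_exp_neg_mul_iteratedDeriv_exp_le {h : ℂ → ℂ} (hh : Differentiable ℂ h) {z : ℂ}
    {δ B : ℝ} (hδ : 0 < δ) (hB : 1 ≤ B) (hbound : ∀ w ∈ Metric.ball z δ, ‖h w‖ ≤ B) (k : ℕ) :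
    ‖exp (-h z) * iteratedDeriv k (fun w => exp (h w)) z‖ ≤
      k.factorial * Real.exp 1 * (4 * B / δ) ^ k := by
  have hρ : 0 < δ / (4 * B) := by positivity
  have hρδ : δ / (4 * B) < δ := by
    rw [div_lt_iff₀ (by positivity)]
    nlinarith
  have hmaps : Set.MapsTo h (Metric.ball z δ) (Metric.closedBall (h z) (2 * B)) := fun w hw => by
    rw [mem_closedBall_iff_norm]
    linarith [norm_sub_le (h w) (h z), hbound w hw, hbound z (Metric.mem_ball_self hδ)]
  have hsphere : ∀ w ∈ Metric.sphere z (δ / (4 * B)), ‖exp (-h z) * exp (h w)‖ ≤ Real.exp 1 := by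
    intro w hw
    rw [Metric.mem_sphere] at hw
    have hdist := dist_le_div_mul_dist_of_mapsTo_ball hh.differentiableOn hmaps
      (Metric.mem_ball.2 (hw.trans_lt hρδ))
    rw [hw, dist_eq_norm] at hdist
    have hhalf : 2 * B / δ * (δ / (4 * B)) = 1 / 2 := by field_simp; norm_num
    rw [← exp_add, norm_exp, Real.exp_le_exp]
    calc (-h z + h w).re ≤ ‖-h z + h w‖ := re_le_norm _
      _ = ‖h w - h z‖ := by rw [neg_add_eq_sub]
      _ ≤ 1 := by linarith
  have hcauchy := norm_iteratedDeriv_le_of_forall_mem_sphere_norm_le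
    (f := fun w => exp (-h z) * exp (h w)) k hρ
    (Differentiable.diffContOnCl (by fun_prop)) hsphere
  rw [iteratedDeriv_const_mul_field] at hcauchy
  refine hcauchy.trans_eq ?_
  rw [div_eq_mul_inv, ← inv_pow, inv_div]

/-- The inequality form of Jensen's formula for entire functions. -/
theorem log_norm_le_circleAverage_s2 {D : ℂ → ℂ} (hD : Differentiable ℂ D) (hD0 : D 0 ≠ 0)
    {R : ℝ} (hR : 0 < R) : Real.log ‖D 0‖ ≤ Real.circleAverage (fun z => Real.log ‖D z‖) 0 R := by
  have han : AnalyticOnNhd ℂ D (Metric.closedBall 0 |R|) := fun z _ => hD.analyticAt z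
  rw [han.circleAverage_log_norm hR.ne' hD0, le_add_iff_nonneg_left]
  refine finsum_nonneg fun u => ?_
  by_cases hu : u ∈ Metric.closedBall (0 : ℂ) |R|
  · refine mul_nonneg (by exact_mod_cast MeromorphicOn.AnalyticOnNhd.divisor_nonneg han u) ?_
    rcases eq_or_ne u 0 with rfl | hu0
    · simp
    · apply Real.log_nonneg
      rw [mem_closedBall_zero_iff, abs_of_pos hR] at hu
      rw [zero_sub, norm_neg, ← div_eq_mul_inv, one_le_div (norm_pos_iff.2 hu0)]
      exact hu
  · simp [hu]

/-- If `D` and `exp (h) * D` are bounded by `exp L` on a circle, then `re h` is bounded inside. -/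
theorem re_le_of_norm_exp_mul_le {h D : ℂ → ℂ} (hh : Differentiable ℂ h) (hD : Differentiable ℂ D)
    (hD0 : D 0 ≠ 0) {R L : ℝ} (hR : 0 < R) (hL : 0 ≤ L)
    (hDL : ∀ z ∈ Metric.sphere (0 : ℂ) R, ‖D z‖ ≤ Real.exp L)
    (hhDL : ∀ z ∈ Metric.sphere (0 : ℂ) R, ‖exp (h z) * D z‖ ≤ Real.exp L)
    {w : ℂ} (hw : w ∈ Metric.ball 0 R) :
    (h w).re ≤ (R + ‖w‖) / (R - ‖w‖) * (L - Real.log ‖D 0‖) := by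
  set K : ℂ → ℝ := re ∘ herglotzRieszKernel 0 w with hK
  have hwR : ‖w‖ < R := mem_ball_zero_iff.1 hw
  have hc : 0 ≤ (R + ‖w‖) / (R - ‖w‖) := div_nonneg (by positivity) (sub_nonneg.2 hwR.le)
  have hK_le : ∀ z ∈ Metric.sphere (0 : ℂ) R, K z ≤ (R + ‖w‖) / (R - ‖w‖) := fun z hz => by
    simpa [hK, herglotzRieszKernel] using re_herglotzRieszKernel_le hz hw
  have hK_nonneg : ∀ z ∈ Metric.sphere (0 : ℂ) R, 0 ≤ K z := fun z hz => by
    have hle := le_re_herglotzRieszKernel hz hw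
    rw [sub_zero] at hle
    refine (div_nonneg (sub_nonneg.2 hwR.le) (by positivity)).trans (hle.trans_eq ?_)
    simp [hK, herglotzRieszKernel]
  have hlog_le : ∀ z ∈ Metric.sphere (0 : ℂ) R, Real.log ‖D z‖ ≤ L := fun z hz => by
    rcases eq_or_ne (D z) 0 with h0 | h0
    · simpa [h0] using hL
    · exact (Real.log_le_iff_le_exp (norm_pos_iff.2 h0)).2 (hDL z hz)
  have hre_le : ∀ z ∈ Metric.sphere (0 : ℂ) R, D z ≠ 0 → (h z).re ≤ L - Real.log ‖D z‖ := by
    intro z hz h0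
    have hle := hhDL z hz
    rw [norm_mul, norm_exp, ← Real.exp_log (norm_pos_iff.2 h0), ← Real.exp_add,
      Real.exp_le_exp] at hle
    linarith
  classical
  set u : ℂ → ℝ := fun z => if D z = 0 then 0 else K z * (h z).re with hu
  have hnz : {z | D z ≠ 0} ∈ Filter.codiscreteWithin (Metric.sphere (0 : ℂ) |R|) :=
    Filter.codiscreteWithin_mono (Set.subset_univ _)
      (AnalyticOnNhd.preimage_zero_mem_codiscrete (fun z _ => hD.analyticAt z) hD0)
  have heq : (K • fun z => (h z).re) =ᶠ[Filter.codiscreteWithin (Metric.sphere (0 : ℂ) |R|)] u := by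
    filter_upwards [hnz] with z hz
    simp [hu, show D z ≠ 0 from hz]
  have hK_cont : ContinuousOn K (Metric.sphere 0 |R|) :=
    continuous_re.comp_continuousOn (continuousOn_herglotzRieszKernel_sphere hw)
  have hint : CircleIntegrable (K • fun z => (h z).re) 0 R :=
    (hK_cont.smul (continuous_re.comp hh.continuous).continuousOn).circleIntegrable'
  have hlogint : CircleIntegrable (fun z => Real.log ‖D z‖) 0 R :=
    MeromorphicOn.circleIntegrable_log_norm fun z _ => (hD.analyticAt z).meromorphicAt
  have hpoisson : Real.circleAverage (K • fun z => (h z).re) 0 R = (h w).re :=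
    InnerProductSpace.HarmonicOnNhd.circleAverage_re_herglotzRieszKernel_smul
      (fun z _ => (hh.analyticAt z).harmonicAt_re) hw
  have hmaj : CircleIntegrable
      (fun z => (R + ‖w‖) / (R - ‖w‖) * (L - Real.log ‖D z‖)) 0 R :=
    ((circleIntegrable_const L 0 R).sub hlogint).const_mul _
  calc (h w).re = Real.circleAverage u 0 R := by
        rw [← hpoisson, Real.circleAverage_congr_codiscreteWithin heq hR.ne']
    _ ≤ Real.circleAverage (fun z => (R + ‖w‖) / (R - ‖w‖) * (L - Real.log ‖D z‖)) 0 R := by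
        refine Real.circleAverage_mono ((circleIntegrable_congr_codiscreteWithin heq).1 hint) hmaj ?_
        intro z hz
        rw [abs_of_pos hR] at hz
        have h1 := sub_nonneg.2 (hlog_le z hz)
        by_cases h0 : D z = 0
        · simpa only [hu, h0, if_true] using mul_nonneg hc (by simpa [h0] using h1)
        · simp only [hu, h0, if_false]
          exact (mul_le_mul_of_nonneg_left (hre_le z hz h0) (hK_nonneg z hz)).trans
            (mul_le_mul_of_nonneg_right (hK_le z hz) h1)
    _ = (R + ‖w‖) / (R - ‖w‖) * (L - Real.circleAverage (fun z => Real.log ‖D z‖) 0 R) := by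
        have := Real.circleAverage_fun_smul (a := (R + ‖w‖) / (R - ‖w‖))
          (f := fun z => L - Real.log ‖D z‖) (c := 0) (R := R)
        simp only [smul_eq_mul] at this
        rw [this, Real.circleAverage_fun_sub (circleIntegrable_const L 0 R) hlogint,
          Real.circleAverage_const]
    _ ≤ _ := by
        gcongr
        exact log_norm_le_circleAverage_s2 hD hD0 hR

/-- A growth inequality on disks, valid at all scales, forces boundedness. -/
theorem exists_norm_le_of_log_growth {H : ℂ → ℝ} (hH : Continuous H) {C : ℝ} (hC : 0 ≤ C)
    (hgrowth : ∀ r δ B : ℝ, 0 < δ → δ ≤ r → 1 ≤ B → (∀ z, ‖z‖ ≤ r + δ → H z ≤ B) →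
      ∀ z, ‖z‖ ≤ r → H z ≤ C * (r / δ) ^ 2 * (1 + Real.log (1 + 12 * B / δ))) :
    ∃ K, ∀ z, H z ≤ K := by
  set k : ℝ := 272 * C + 1 with hk
  have hk1 : 1 ≤ k := by linarith
  refine ⟨k ^ 4, fun z₀ => ?_⟩
  by_contra! hz₀
  set s : ℝ := max 1 ‖z₀‖
  have hs : 1 ≤ s := le_max_left _ _
  have hiter : ∀ i : ℕ, ∃ z, ‖z‖ ≤ s * (2 - (1 / 2) ^ i) ∧ k ^ 4 * 8 ^ i < H z := by
    intro i
    induction i with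
    | zero => exact ⟨z₀, by norm_num; exact le_max_right _ _, by simpa using hz₀⟩
    | succ i ih =>
      obtain ⟨z, hz, hHz⟩ := ih
      by_contra! hcon
      have hp : ((1 : ℝ) / 2) ^ i ≤ 1 := pow_le_one₀ (by norm_num) (by norm_num)
      have hp0 : (0 : ℝ) < (1 / 2) ^ i := by positivity
      set r : ℝ := s * (2 - (1 / 2) ^ i) with hr
      set δ : ℝ := s * (1 / 2) ^ (i + 1) with hδ
      have hδ0 : 0 < δ := by positivity
      have hrδ : r + δ = s * (2 - (1 / 2) ^ (i + 1)) := by rw [hr, hδ, pow_succ]; ring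
      have hδr : δ ≤ r := by
        rw [hr, hδ, pow_succ]
        exact mul_le_mul_of_nonneg_left (by linarith) (by linarith)
      have hB : (1 : ℝ) ≤ k ^ 4 * 8 ^ (i + 1) :=
        one_le_mul_of_one_le_of_one_le (one_le_pow₀ hk1) (one_le_pow₀ (by norm_num))
      have hle := hgrowth r δ _ hδ0 hδr hB (fun w hw => hcon w (hrδ ▸ hw)) z hz
      have h2 : (1 : ℝ) ≤ 2 ^ i := one_le_pow₀ (by norm_num)
      have h8 : (8 : ℝ) ^ i = (2 ^ i) ^ 3 := by rw [← pow_mul, mul_comm, pow_mul]; norm_num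
      have hinv : ((1 : ℝ) / 2) ^ i * 2 ^ i = 1 := by rw [← mul_pow]; norm_num
      have hratio : r / δ ≤ 4 * 2 ^ i := by
        rw [div_le_iff₀ hδ0, hr, hδ, pow_succ]
        have : 4 * 2 ^ i * (s * ((1 / 2) ^ i * (1 / 2))) = 2 * s * ((1 / 2) ^ i * 2 ^ i) := by ring
        rw [this, hinv]
        nlinarith
      have hx : 12 * (k ^ 4 * 8 ^ (i + 1)) / δ ≤ 192 * (k * 2 ^ i) ^ 4 := by
        rw [div_le_iff₀ hδ0, hδ, pow_succ (1 / 2 : ℝ), pow_succ (8 : ℝ)]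
        have : 192 * (k * 2 ^ i) ^ 4 * (s * ((1 / 2) ^ i * (1 / 2))) =
          96 * k ^ 4 * (2 ^ i) ^ 3 * s * ((1 / 2) ^ i * 2 ^ i) := by ring
        rw [this, hinv, h8]
        have : 0 ≤ 96 * k ^ 4 * ((2 : ℝ) ^ i) ^ 3 := by positivity
        nlinarith
      have hk2 : 1 ≤ k * 2 ^ i := one_le_mul_of_one_le_of_one_le hk1 h2
      have hlog : Real.log (1 + 12 * (k ^ 4 * 8 ^ (i + 1)) / δ) ≤ 16 * (k * 2 ^ i) := by
        have h4 : 1 + 12 * (k ^ 4 * 8 ^ (i + 1)) / δ ≤ (4 * (k * 2 ^ i)) ^ 4 := by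
          have := one_le_pow₀ hk2 (n := 4)
          rw [mul_pow]
          linarith
        calc _ ≤ Real.log ((4 * (k * 2 ^ i)) ^ 4) := Real.log_le_log (by positivity) h4
          _ = 4 * Real.log (4 * (k * 2 ^ i)) := by rw [Real.log_pow]; norm_num
          _ ≤ 4 * (4 * (k * 2 ^ i)) := by
              gcongr
              exact Real.log_le_self (by positivity)
          _ = _ := by ring
      have hfinal : C * (r / δ) ^ 2 * (1 + Real.log (1 + 12 * (k ^ 4 * 8 ^ (i + 1)) / δ)) ≤
          C * (4 * 2 ^ i) ^ 2 * (17 * (k * 2 ^ i)) := by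
        have : 0 ≤ r / δ := div_nonneg (hδ0.le.trans hδr) hδ0.le
        have : 0 ≤ Real.log (1 + 12 * (k ^ 4 * 8 ^ (i + 1)) / δ) :=
          Real.log_nonneg (le_add_of_nonneg_right (by positivity))
        gcongr
        linarith
      have hlast : C * (4 * 2 ^ i) ^ 2 * (17 * (k * 2 ^ i)) ≤ k ^ 4 * 8 ^ i := by
        rw [h8]
        have : C * (4 * 2 ^ i) ^ 2 * (17 * (k * 2 ^ i)) = (272 * C) * (k * (2 ^ i) ^ 3) := by ring
        rw [this]
        have h1 : 272 * C ≤ k ^ 3 := by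
          have := le_self_pow₀ hk1 (n := 3) (by norm_num)
          linarith
        calc _ ≤ k ^ 3 * (k * (2 ^ i) ^ 3) := by gcongr
          _ = _ := by ring
      linarith
  obtain ⟨M, hM⟩ := (isCompact_closedBall (0 : ℂ) (2 * s)).bddAbove_image hH.continuousOn
  obtain ⟨i, hi⟩ := pow_unbounded_of_one_lt M (by norm_num : (1 : ℝ) < 8)
  obtain ⟨z, hz, hHz⟩ := hiter i
  have hzs : z ∈ Metric.closedBall (0 : ℂ) (2 * s) := by
    rw [mem_closedBall_zero_iff]
    have : (0 : ℝ) < (1 / 2) ^ i := by positivity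
    nlinarith
  have h1 := hM (Set.mem_image_of_mem H hzs)
  have h2 : (8 : ℝ) ^ i ≤ k ^ 4 * 8 ^ i :=
    le_mul_of_one_le_left (by positivity) (one_le_pow₀ hk1)
  linarith
/-- Linearly independent entire functions have a nonvanishing generalized Wronskian at `0`. -/
theorem exists_det_iteratedDeriv_ne_zero {ι : Type*} [Fintype ι] [DecidableEq ι] {F : ι → ℂ → ℂ}
    (hF : ∀ j, Differentiable ℂ (F j)) (hlin : LinearIndependent ℂ F) :
    ∃ k : ι → ℕ, (Matrix.of fun i j => iteratedDeriv (k i) (F j) 0).det ≠ 0 := by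
  set v : ℕ → ι → ℂ := fun k j => iteratedDeriv k (F j) 0
  have hspan : Submodule.span ℂ (Set.range v) = ⊤ := by
    by_contra hne
    obtain ⟨φ, hφ, hφv⟩ := Submodule.exists_dual_map_eq_bot_of_lt_top (lt_top_iff_ne_top.2 hne)
      inferInstance
    have hφ0 : ∀ k, ∑ j, φ (Pi.single j 1) * v k j = 0 := fun k => by
      have hk : φ (v k) = 0 := by
        have := Submodule.mem_map_of_mem (f := φ) (Submodule.subset_span (Set.mem_range_self (f := v) k))
        rwa [hφv, Submodule.mem_bot] at this
      rw [← hk, LinearMap.pi_apply_eq_sum_univ φ (v k)]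
      refine Finset.sum_congr rfl fun j _ => ?_
      rw [smul_eq_mul, mul_comm]
      congr 2
      ext i
      simp [Pi.single_apply, eq_comm]
    have hsum : ∑ j, φ (Pi.single j 1) • F j = 0 := by
      ext z
      have hdiff : Differentiable ℂ fun z => ∑ j, φ (Pi.single j 1) * F j z :=
        Differentiable.fun_sum fun j _ => (hF j).const_mul _
      have hder : ∀ k, iteratedDeriv k (fun z => ∑ j, φ (Pi.single j 1) * F j z) 0 = 0 := by
        intro k
        rw [iteratedDeriv_fun_sum fun j _ => ((hF j).const_mul _).contDiff.contDiffAt]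
        simpa only [iteratedDeriv_const_mul_field] using hφ0 k
      have := taylorSeries_eq_of_entire' 0 z hdiff
      simp only [hder, mul_zero, zero_mul, tsum_zero] at this
      simpa using this.symm
    refine hφ (LinearMap.pi_ext' fun j => LinearMap.ext_ring ?_)
    simpa using Fintype.linearIndependent_iff.1 hlin _ hsum j
  obtain ⟨κ, a, -, hspan', hli⟩ := exists_linearIndependent' ℂ v
  let b := Module.Basis.mk hli (by rw [hspan', hspan])
  let e : ι ≃ κ := (Pi.basisFun ℂ ι).indexEquiv b
  refine ⟨a ∘ e, ?_⟩
  rw [← isUnit_iff_ne_zero, ← Matrix.isUnit_iff_isUnit_det,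
    ← Matrix.linearIndependent_rows_iff_isUnit]
  exact hli.comp e e.injective

/-- Cramer's rule with explicit bounds. -/
theorem norm_det_mul_le_of_mulVec_eq {ι : Type*} [Fintype ι] [DecidableEq ι] {A : Matrix ι ι ℂ}
    {x b : ι → ℂ} (hAx : A.mulVec x = b) {c : ℝ} (hA : ∀ i j, ‖A i j‖ ≤ c) (hb : ∀ i, ‖b i‖ ≤ c)
    (j : ι) : ‖x j * A.det‖ ≤ (Fintype.card ι).factorial * c ^ Fintype.card ι := by
  have hcramer : x j * A.det = (A.updateCol j b).det := by
    rw [← Matrix.cramer_apply, Matrix.cramer_eq_adjugate_mulVec, ← hAx, Matrix.mulVec_mulVec,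
      Matrix.adjugate_mul, Matrix.smul_mulVec, Matrix.one_mulVec, Pi.smul_apply, smul_eq_mul,
      mul_comm]
  rw [hcramer, ← nsmul_eq_mul]
  refine Matrix.det_le (abv := NormedField.toAbsoluteValue ℂ) fun i l => ?_
  change ‖A.updateCol j b i l‖ ≤ c
  rcases eq_or_ne l j with rfl | hl
  · simpa using hb i
  · simpa [Matrix.updateCol_ne hl] using hA i l

/-- A growth inequality for entire functions `h j` with `∑ j, exp (h j) = 1`, bounding them on a
disk by the logarithm of a bound on a larger disk. -/
theorem norm_le_of_sum_exp_eq_one {ι : Type*} [Fintype ι] {h : ι → ℂ → ℂ}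
    (hh : ∀ j, Differentiable ℂ (h j)) (hlin : LinearIndependent ℂ fun j z => exp (h j z))
    (hsum : ∀ z, ∑ j, exp (h j z) = 1) :
    ∃ C : ℝ, 0 ≤ C ∧ ∀ r δ B : ℝ, 0 < δ → δ ≤ r → 1 ≤ B →
      (∀ z, ‖z‖ ≤ r + δ → ∀ j, ‖h j z‖ ≤ B) →
      ∀ z, ‖z‖ ≤ r → ∀ j, ‖h j z‖ ≤ C * (r / δ) ^ 2 * (1 + Real.log (1 + 12 * B / δ)) := by
  classical
  have hexp : ∀ j, Differentiable ℂ fun z => exp (h j z) := fun j => (hh j).cexp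
  obtain ⟨k, hk⟩ := exists_det_iteratedDeriv_ne_zero hexp hlin
  set A : ℂ → Matrix ι ι ℂ := fun z =>
    Matrix.of fun i j => exp (-h j z) * iteratedDeriv (k i) (fun w => exp (h j w)) z
  have hAdiff : Differentiable ℂ fun z => (A z).det := by
    simp only [Matrix.det_apply]
    refine Differentiable.fun_sum fun σ _ => Differentiable.fun_const_smul ?_ _
    refine Differentiable.fun_finsetProd fun i _ => ?_
    exact ((hh i).neg.cexp).mul
      ((hexp i).contDiff.differentiable_iteratedDeriv _ (n := ⊤) (by simp))
  have hA0 : (A 0).det ≠ 0 := by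
    have : (A 0).det = (∏ j, exp (-h j 0)) *
        (Matrix.of fun i j => iteratedDeriv (k i) (fun w => exp (h j w)) 0).det :=
      Matrix.det_mul_row _ _
    rw [this]
    exact mul_ne_zero (Finset.prod_ne_zero_iff.2 fun j _ => exp_ne_zero _) hk
  have hAmul : ∀ z, (A z).mulVec (fun j => exp (h j z)) = fun i => if k i = 0 then 1 else 0 := by
    intro z
    ext i
    have hterm : ∀ j, A z i j * exp (h j z) = iteratedDeriv (k i) (fun w => exp (h j w)) z := by
      intro j
      change exp (-h j z) * iteratedDeriv (k i) (fun w => exp (h j w)) z * exp (h j z) = _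
      rw [mul_right_comm, ← exp_add, neg_add_cancel, exp_zero, one_mul]
    simp only [Matrix.mulVec, dotProduct, hterm]
    rw [← iteratedDeriv_fun_sum fun j _ => (hexp j).contDiff.contDiffAt, funext hsum,
      iteratedDeriv_const]
  obtain ⟨N, hN⟩ : ∃ N, ∀ i, k i ≤ N := ⟨∑ i, k i, fun i =>
    Finset.single_le_sum (fun _ _ => Nat.zero_le _) (Finset.mem_univ i)⟩
  set n := Fintype.card ι
  set E : ℝ := N.factorial * Real.exp 1 with hE
  have hE1 : 1 ≤ E := one_le_mul_of_one_le_of_one_le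
    (by exact_mod_cast N.factorial_pos) (Real.one_le_exp zero_le_one)
  set a : ℝ := Real.log (n.factorial * E ^ n) + |Real.log ‖(A 0).det‖|
  have hn1 : (1 : ℝ) ≤ n.factorial * E ^ n := one_le_mul_of_one_le_of_one_le
    (by exact_mod_cast n.factorial_pos) (one_le_pow₀ hE1)
  have ha0 : 0 ≤ a := add_nonneg (Real.log_nonneg hn1) (abs_nonneg _)
  set S : ℝ := ∑ j, ‖h j 0‖
  have hS0 : 0 ≤ S := Finset.sum_nonneg fun _ _ => norm_nonneg _
  refine ⟨72 * (a + N * n + 1) + 9 * S, by positivity, fun r δ B hδ hδr hB hbound z hz j => ?_⟩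
  have hr : 0 < r := hδ.trans_le hδr
  set q : ℝ := 1 + 12 * B / δ
  have hq1 : 1 ≤ q := le_add_of_nonneg_right (by positivity)
  have hℓ : 0 ≤ Real.log q := Real.log_nonneg hq1
  set c : ℝ := E * q ^ N with hc
  have hc1 : 1 ≤ c := one_le_mul_of_one_le_of_one_le hE1 (one_le_pow₀ hq1)
  set R : ℝ := r + 2 * δ / 3 with hR
  have hR0 : 0 < R := by positivity
  have hentry : ∀ z ∈ Metric.sphere (0 : ℂ) R, ∀ i j, ‖A z i j‖ ≤ c := by
    intro z hz i j
    rw [mem_sphere_zero_iff_norm] at hz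
    have hball : ∀ w ∈ Metric.ball z (δ / 3), ‖h j w‖ ≤ B := fun w hw => by
      refine hbound w ?_ j
      rw [mem_ball_iff_norm] at hw
      linarith [norm_le_norm_sub_add w z]
    refine (norm_exp_neg_mul_iteratedDeriv_exp_le (hh j) (by positivity) hB hball (k i)).trans ?_
    have hq' : 4 * B / (δ / 3) = 12 * B / δ := by field_simp; norm_num
    rw [hc, hE, hq']
    have hpow : (12 * B / δ) ^ k i ≤ q ^ N :=
      (pow_le_pow_left₀ (by positivity) (by linarith) _).trans (pow_le_pow_right₀ hq1 (hN i))
    have hfac : ((k i).factorial : ℝ) ≤ N.factorial := by exact_mod_cast Nat.factorial_le (hN i)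
    gcongr
  set L : ℝ := Real.log (n.factorial * c ^ n) with hL
  have hLpos : (1 : ℝ) ≤ n.factorial * c ^ n := one_le_mul_of_one_le_of_one_le
    (by exact_mod_cast n.factorial_pos) (one_le_pow₀ hc1)
  have hL0 : 0 ≤ L := Real.log_nonneg hLpos
  have hexpL : Real.exp L = n.factorial * c ^ n := Real.exp_log (by linarith)
  have hL_eq : L = Real.log (n.factorial * E ^ n) + N * n * Real.log q := by
    rw [hL, hc, mul_pow, ← mul_assoc, Real.log_mul (by positivity) (by positivity), ← pow_mul,
      Real.log_pow, Nat.cast_mul]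
  have hdet : ∀ z ∈ Metric.sphere (0 : ℂ) R, ‖(A z).det‖ ≤ Real.exp L := fun z hz => by
    rw [hexpL, ← nsmul_eq_mul]
    exact Matrix.det_le (abv := NormedField.toAbsoluteValue ℂ) (hentry z hz)
  have hexpdet : ∀ z ∈ Metric.sphere (0 : ℂ) R, ‖exp (h j z) * (A z).det‖ ≤ Real.exp L := by
    intro z hz
    rw [hexpL]
    refine norm_det_mul_le_of_mulVec_eq (hAmul z) (hentry z hz) (fun i => ?_) j
    split_ifs <;> simp <;> linarith
  set t : ℝ := r / δ with ht
  have ht1 : 1 ≤ t := (one_le_div hδ).2 hδr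
  have hrt : r = t * δ := by rw [ht, div_mul_cancel₀ _ hδ.ne']
  set M : ℝ := 12 * t * (L + |Real.log ‖(A 0).det‖|) + 1 with hM
  have hM0 : 0 < M := by positivity
  have hmaps : Set.MapsTo (h j) (Metric.ball 0 (r + δ / 3)) {w | w.re ≤ M} := by
    intro w hw
    rw [mem_ball_zero_iff] at hw
    have hwR : ‖w‖ < R := by linarith
    have hre := re_le_of_norm_exp_mul_le (hh j) hAdiff hA0 hR0 hL0 hdet hexpdet
      (mem_ball_zero_iff.2 hwR)
    have hfrac : (R + ‖w‖) / (R - ‖w‖) ≤ 12 * t := by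
      rw [div_le_iff₀ (by linarith)]
      calc R + ‖w‖ ≤ 12 * (t * (δ / 3)) := by linarith
        _ ≤ 12 * (t * (R - ‖w‖)) := by gcongr; linarith
        _ = _ := by ring
    have hsub : L - Real.log ‖(A 0).det‖ ≤ L + |Real.log ‖(A 0).det‖| := by
      linarith [neg_abs_le (Real.log ‖(A 0).det‖)]
    calc (h j w).re ≤ _ := hre
      _ ≤ (R + ‖w‖) / (R - ‖w‖) * (L + |Real.log ‖(A 0).det‖|) :=
        mul_le_mul_of_nonneg_left hsub (div_nonneg (by positivity) (by linarith))
      _ ≤ 12 * t * (L + |Real.log ‖(A 0).det‖|) := by gcongr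
      _ ≤ M := by linarith
  have hbc := borelCaratheodory hM0 (hh j).differentiableOn hmaps (by positivity)
    (mem_ball_zero_iff.2 (show ‖z‖ < r + δ / 3 by linarith))
  have hden : δ / 3 ≤ r + δ / 3 - ‖z‖ := by linarith
  have hfirst : 2 * M * ‖z‖ / (r + δ / 3 - ‖z‖) ≤ 6 * M * t := by
    calc 2 * M * ‖z‖ / (r + δ / 3 - ‖z‖) ≤ 2 * M * r / (δ / 3) := by gcongr
      _ = 6 * M * t := by rw [hrt]; field_simp; norm_num
  have hsecond : ‖h j 0‖ * (r + δ / 3 + ‖z‖) / (r + δ / 3 - ‖z‖) ≤ 9 * S * t := by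
    have hSj : ‖h j 0‖ ≤ S :=
      Finset.single_le_sum (f := fun j => ‖h j 0‖) (fun _ _ => norm_nonneg _) (Finset.mem_univ j)
    calc _ ≤ S * (3 * r) / (δ / 3) := by gcongr; linarith
      _ = 9 * S * t := by rw [hrt]; field_simp; norm_num
  have hLa : L + |Real.log ‖(A 0).det‖| ≤ (a + N * n) * (1 + Real.log q) := by
    have h1 : 0 ≤ a * Real.log q := mul_nonneg ha0 hℓ
    have h2 : (0 : ℝ) ≤ N * n := by positivity
    rw [hL_eq]
    linarith
  have ht2 : t ≤ t ^ 2 := le_self_pow₀ ht1 two_ne_zero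
  have hMt : 6 * M * t ≤ 72 * (a + N * n + 1) * t ^ 2 * (1 + Real.log q) := by
    calc 6 * M * t = 72 * t ^ 2 * (L + |Real.log ‖(A 0).det‖|) + 6 * t := by rw [hM]; ring
      _ ≤ 72 * t ^ 2 * ((a + N * n) * (1 + Real.log q)) + 72 * t ^ 2 * (1 + Real.log q) := by
        refine add_le_add (by gcongr) ?_
        nlinarith [mul_nonneg (sq_nonneg t) hℓ]
      _ = _ := by ring
  have hSt : 9 * S * t ≤ 9 * S * t ^ 2 * (1 + Real.log q) := by
    calc 9 * S * t ≤ 9 * S * t ^ 2 := by gcongr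
      _ ≤ _ := le_mul_of_one_le_right (by positivity) (by linarith)
  calc ‖h j z‖ ≤ _ := hbc
    _ ≤ 6 * M * t + 9 * S * t := add_le_add hfirst hsecond
    _ ≤ _ := add_le_add hMt hSt
    _ = _ := by ring

/-- Entire functions with linearly independent exponentials adding up to `1` are constant. -/
theorem exists_eq_const_of_sum_exp_eq_one {ι : Type*} [Fintype ι] {h : ι → ℂ → ℂ}
    (hh : ∀ j, Differentiable ℂ (h j)) (hlin : LinearIndependent ℂ fun j z => exp (h j z))
    (hsum : ∀ z, ∑ j, exp (h j z) = 1) (j : ι) : ∃ c, ∀ z, h j z = c := by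
  obtain ⟨C, hC, hgrowth⟩ := norm_le_of_sum_exp_eq_one hh hlin hsum
  obtain ⟨K, hK⟩ := exists_norm_le_of_log_growth (H := fun z => ‖fun j => h j z‖)
    (continuous_pi fun j => (hh j).continuous).norm hC
    fun r δ B hδ hδr hB hbound z hz => by
      have hq : 0 ≤ Real.log (1 + 12 * B / δ) :=
        Real.log_nonneg (le_add_of_nonneg_right (by positivity))
      refine (pi_norm_le_iff_of_nonneg (by positivity)).2 fun j =>
        hgrowth r δ B hδ hδr hB (fun w hw j => ?_) z hz j
      exact (norm_le_pi_norm (fun j => h j w) j).trans (hbound w hw)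
  refine (hh j).exists_const_forall_eq_of_bounded (isBounded_iff_forall_norm_le.2 ⟨K, ?_⟩)
  rintro _ ⟨z, rfl⟩
  exact (norm_le_pi_norm (fun j => h j z) j).trans (hK z)

/-- **Borel's theorem**: exponentials of entire functions that pairwise do not differ by a constant
are linearly independent. -/
theorem linearIndependent_exp_of_sub_ne_const {ι : Type*} {g : ι → ℂ → ℂ}
    (hg : ∀ i, Differentiable ℂ (g i)) (hne : ∀ i j, i ≠ j → ∀ c, ∃ z, g i z - g j z ≠ c) :
    LinearIndependent ℂ fun i z => exp (g i z) := by
  classical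
  rw [linearIndependent_iff_finset_linearIndependent]
  intro s
  change LinearIndepOn ℂ (fun i z => exp (g i z)) (s : Set ι)
  induction s using Finset.induction_on with
  | empty => simp
  | insert i₀ s hi₀ ih =>
    rw [Finset.coe_insert, linearIndepOn_insert (by simpa using hi₀)]
    refine ⟨ih, fun hmem => ?_⟩
    obtain ⟨c, hc⟩ := (Submodule.mem_span_image_finset_iff_exists_fun' ℂ).1 hmem
    replace hc : ∀ z, ∑ i ∈ s, c i * exp (g i z) = exp (g i₀ z) := fun z => by
      simpa using congrFun hc z
    set t := {i ∈ s | c i ≠ 0} with ht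
    have hct : ∀ i : t, c i ≠ 0 := fun i => (Finset.mem_filter.1 i.2).2
    set h : t → ℂ → ℂ := fun i z => g i z - g i₀ z + log (c i) with hh
    have hexp : ∀ (i : t) z, exp (h i z) = exp (-g i₀ z) * (c i * exp (g i z)) := fun i z => by
      rw [hh, exp_add, exp_log (hct i), sub_eq_neg_add, exp_add]
      ring
    have hlin : LinearIndependent ℂ fun i z => exp (h i z) := by
      refine Fintype.linearIndependent_iff.2 fun d hd i => ?_
      have ht_lin : LinearIndependent ℂ fun (i : t) z => exp (g i z) :=
        ih.mono (Finset.coe_subset.2 (Finset.filter_subset _ _))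
      have hdc := Fintype.linearIndependent_iff.1 ht_lin (fun i => d i * c i) ?_ i
      · exact (mul_eq_zero.1 hdc).resolve_right (hct i)
      · ext z
        have hz := congrFun hd z
        simp only [Finset.sum_apply, Pi.smul_apply, smul_eq_mul, hexp, Pi.zero_apply] at hz ⊢
        refine (mul_eq_zero.1 ?_).resolve_left (exp_ne_zero (-g i₀ z))
        rw [← hz, Finset.mul_sum]
        exact Finset.sum_congr rfl fun i _ => by ring
    have hsum_t : ∀ z, ∑ i : t, c i * exp (g i z) = exp (g i₀ z) := fun z => by
      rw [Finset.sum_coe_sort t fun i => c i * exp (g i z), ← hc z, ht]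
      refine Finset.sum_filter_of_ne fun i _ hi => left_ne_zero_of_mul hi
    have hsum : ∀ z, ∑ i, exp (h i z) = 1 := fun z => by
      simp only [hexp]
      rw [← Finset.mul_sum, hsum_t, ← exp_add, neg_add_cancel, exp_zero]
    obtain ⟨i, hi⟩ : t.Nonempty := by
      rw [← Finset.nonempty_coe_sort]
      by_contra hempty
      rw [not_nonempty_iff] at hempty
      simpa using hsum 0
    obtain ⟨a, ha⟩ := exists_eq_const_of_sum_exp_eq_one
      (fun i : t => ((hg i).sub (hg i₀)).add_const (log (c i))) hlin hsum ⟨i, hi⟩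
    obtain ⟨z, hz⟩ := hne i i₀ (fun h => hi₀ (h ▸ (Finset.mem_filter.1 hi).1)) (a - log (c i))
    exact hz (eq_sub_of_add_eq (ha z))

/-- If `f 1, …, f n` are entire functions such that the functions `z ↦ f j z - f j 0`
are linearly independent over `ℚ`, then the entire functions `e^{f 1}, …, e^{f n}`
are algebraically independent over `ℂ`. -/
theorem exp_algebraically_independent (n : ℕ) (hn : 1 ≤ n)
    (f : Fin n → ℂ → ℂ) (hf : ∀ j, Differentiable ℂ (f j))
    (hQ : LinearIndependent ℚ (fun j : Fin n => fun z : ℂ => f j z - f j 0)) :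
    AlgebraicIndependent ℂ (fun j : Fin n => fun z : ℂ => Complex.exp (f j z)) := by
  have hlin : LinearIndependent ℂ fun (m : Fin n →₀ ℕ) z => exp (∑ j, (m j : ℂ) * f j z) := by
    refine linearIndependent_exp_of_sub_ne_const
      (fun m => Differentiable.fun_sum fun j _ => (hf j).const_mul _) fun m m' hmm' c => ?_
    by_contra! hconst
    refine hmm' (Finsupp.ext fun j => ?_)
    have hzero := Fintype.linearIndependent_iff.1 hQ (fun j => (m j : ℚ) - m' j) ?_ j
    · exact_mod_cast sub_eq_zero.1 hzero
    · ext z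
      have hz := (hconst z).trans (hconst 0).symm
      simp only [← Finset.sum_sub_distrib] at hz
      rw [← sub_eq_zero, ← Finset.sum_sub_distrib] at hz
      simp only [Finset.sum_apply, Pi.smul_apply, Rat.smul_def, Pi.zero_apply]
      refine Eq.trans ?_ hz
      refine Finset.sum_congr rfl fun j _ => ?_
      push_cast
      ring
  refine algebraicIndependent_iff.2 fun p hp => ?_
  have heval : ∀ z, ∑ m ∈ p.support, p.coeff m * exp (∑ j, (m j : ℂ) * f j z) = 0 := fun z => by
    have hz := congrFun hp z
    rw [MvPolynomial.aeval_def, MvPolynomial.eval₂_eq'] at hz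
    simpa [exp_sum, exp_nat_mul] using hz
  ext m
  by_contra hm
  refine hm (linearIndependent_iff'.1 hlin p.support p.coeff ?_ m
    (MvPolynomial.mem_support_iff.2 hm))
  ext z
  simpa using heval z
end

section
/- Let n ≥ 1 and let α_1, …, α_n be complex numbers that are linearly independent over ℚ. Then the n+1 entire functions z ↦ z, z ↦ e^{α_1 z}, …, z ↦ e^{α_n z} are algebraically independent over ℂ. -/
open Complex

/-- The twisted derivation `p ↦ p' + c p` is injective on complex polynomials when `c ≠ 0`. -/
theorem Polynomial.eq_zero_of_derivative_add_C_mul_eq_zero {c : ℂ} (hc : c ≠ 0)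
    {p : Polynomial ℂ} (h : derivative p + C c * p = 0) : p = 0 := by
  by_contra hp
  have hlt : (derivative p).degree < (C c * p).degree := by
    rw [degree_C_mul hc]
    exact degree_derivative_lt hp
  rw [← degree_add_eq_right_of_degree_lt hlt, h, degree_zero] at hlt
  exact not_lt_bot hlt

/-- An exponential polynomial with pairwise distinct frequencies that vanishes identically has
all its polynomial coefficients equal to zero. -/
theorem eq_zero_of_sum_eval_mul_exp_eq_zero {ι : Type*} (s : Finset ι) (b : ι → ℂ)
    (hb : Set.InjOn b s) (p : ι → Polynomial ℂ)
    (h : ∀ z : ℂ, ∑ i ∈ s, (p i).eval z * exp (b i * z) = 0) : ∀ i ∈ s, p i = 0 := by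
  classical
  induction s using Finset.induction_on generalizing b p with
  | empty => simp
  | insert a s ha ih =>
    have hbs : Set.InjOn b s := hb.mono (by simp)
    have hba : ∀ i ∈ s, b i - b a ≠ 0 := fun i hi h0 =>
      ha (hb (by simp [hi]) (by simp) (sub_eq_zero.mp h0) ▸ hi)
    have key : ∀ (N : ℕ) (q : Polynomial ℂ) (r : ι → Polynomial ℂ),
        Polynomial.derivative^[N] q = 0 →
        (∀ z : ℂ, q.eval z + ∑ i ∈ s, (r i).eval z * exp ((b i - b a) * z) = 0) →
        ∀ i ∈ s, r i = 0 := by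
      intro N
      induction N with
      | zero =>
        intro q r hq hz
        refine ih (fun i => b i - b a) (fun i hi j hj hij => hbs hi hj (sub_left_injective hij)) r ?_
        intro z
        have hq0 : q = 0 := hq
        simpa [hq0] using hz z
      | succ N ihN =>
        intro q r hq hz i hi
        refine Polynomial.eq_zero_of_derivative_add_C_mul_eq_zero (hba i hi) ?_
        refine ihN (Polynomial.derivative q)
          (fun i => Polynomial.derivative (r i) + Polynomial.C (b i - b a) * r i) hq ?_ i hi
        intro z
        have hd : HasDerivAt
            (fun z : ℂ => q.eval z + ∑ i ∈ s, (r i).eval z * exp ((b i - b a) * z))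
            (q.derivative.eval z + ∑ i ∈ s, ((r i).derivative.eval z * exp ((b i - b a) * z) +
              (r i).eval z * (exp ((b i - b a) * z) * ((b i - b a) * 1)))) z :=
          (q.hasDerivAt z).add (HasDerivAt.fun_sum fun i _ =>
            ((r i).hasDerivAt z).mul ((hasDerivAt_id z).const_mul (b i - b a)).cexp)
        rw [funext hz] at hd
        rw [← hd.unique (hasDerivAt_const z 0)]
        congr 1
        refine Finset.sum_congr rfl fun i _ => ?_
        simp only [Polynomial.eval_add, Polynomial.eval_mul, Polynomial.eval_C]
        ring
    have hs : ∀ i ∈ s, p i = 0 := by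
      refine key ((p a).natDegree + 1) (p a) p
        (Polynomial.iterate_derivative_eq_zero (Nat.lt_succ_self _)) fun z => ?_
      have hz := congrArg (· * exp (-(b a * z))) (h z)
      simp only [Finset.sum_insert ha, zero_mul, add_mul, Finset.sum_mul, mul_assoc,
        ← exp_add] at hz
      simpa [sub_mul, sub_eq_add_neg, add_mul] using hz
    intro i hi
    rcases Finset.mem_insert.mp hi with rfl | hi
    · refine Polynomial.funext fun z => ?_
      have hz := h z
      rw [Finset.sum_insert ha, Finset.sum_eq_zero fun j hj => by simp [hs j hj]] at hz
      simpa using hz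
    · exact hs i hi

/-- Evaluating a polynomial in `z` and further functions at a point, through its expansion as a
polynomial in the further functions with coefficients in `ℂ[z]`. -/
theorem MvPolynomial.aeval_option_elim_id_apply {σ : Type*} (g : σ → ℂ → ℂ)
    (P : MvPolynomial (Option σ) ℂ) (z : ℂ) :
    aeval (fun o : Option σ => o.elim (fun z : ℂ => z) g) P z =
      eval₂ (Polynomial.evalRingHom z) (fun j => g j z) (optionEquivRight ℂ σ P) := by
  induction P using MvPolynomial.induction_on with
  | C a => simp
  | add p q hp hq => simp [hp, hq]
  | mul_X p o hp =>
    cases o <;> simp [hp]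

/-- If `α 1, …, α n` are complex numbers linearly independent over `ℚ`, then the `n + 1`
entire functions `z ↦ z, z ↦ e^{α 1 z}, …, z ↦ e^{α n z}` are algebraically independent
over `ℂ`. -/
theorem ax_schanuel_one_parameter (n : ℕ) (hn : 1 ≤ n)
    (α : Fin n → ℂ) (hα : LinearIndependent ℚ α) :
    AlgebraicIndependent ℂ
      (fun o : Option (Fin n) =>
        o.elim (fun z : ℂ => z) (fun j => fun z : ℂ => Complex.exp (α j * z))) := by
  rw [algebraicIndependent_iff]
  intro P hP
  rw [← map_eq_zero_iff _ (MvPolynomial.optionEquivRight ℂ (Fin n)).injective]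
  set Q := MvPolynomial.optionEquivRight ℂ (Fin n) P with hQ
  have hinj : Function.Injective fun d : Fin n →₀ ℕ => ∑ j, (d j : ℂ) * α j := by
    intro d e hde
    ext j
    have h0 : ∑ j, ((d j : ℚ) - (e j : ℚ)) • α j = 0 := by
      simpa [sub_smul, Finset.sum_sub_distrib, sub_eq_zero, Rat.smul_def, sub_mul] using hde
    exact_mod_cast sub_eq_zero.mp (Fintype.linearIndependent_iff.mp hα _ h0 j)
  have hcoeff := eq_zero_of_sum_eval_mul_exp_eq_zero Q.support
    (fun d => ∑ j, (d j : ℂ) * α j) hinj.injOn (fun d => Q.coeff d) fun z => by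
      have hz := congrFun hP z
      rw [MvPolynomial.aeval_option_elim_id_apply, ← hQ, MvPolynomial.eval₂_eq'] at hz
      rw [Pi.zero_apply] at hz
      rw [← hz]
      refine Finset.sum_congr rfl fun d _ => ?_
      simp only [Finset.sum_mul, exp_sum, ← exp_nat_mul, mul_assoc, Polynomial.coe_evalRingHom]
  ext1 d
  by_cases hd : d ∈ Q.support
  · exact hcoeff d hd
  · exact MvPolynomial.notMem_support_iff.mp hd
end

section
/- Let exp_{(0)}(z) = z and exp_{(k+1)}(z) = exp(exp_{(k)}(z)) denote the iterated exponential functions. Then for every n ≥ 1 the n+1 entire functions exp_{(0)}, exp_{(1)}, …, exp_{(n)} (that is, z, e^z, e^{e^z}, …) are algebraically independent over ℂ. -/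
open Complex

/-- The iterated exponential functions: `expIter 0 z = z` and
`expIter (k+1) z = exp (expIter k z)`. -/
noncomputable def expIter : ℕ → ℂ → ℂ
  | 0 => fun z => z
  | k + 1 => fun z => Complex.exp (expIter k z)

/-- The restriction of `expIter` to the real line. -/
noncomputable def realExpIter : ℕ → ℝ → ℝ
  | 0 => fun x => x
  | k + 1 => fun x => Real.exp (realExpIter k x)

theorem expIter_ofReal (k : ℕ) (x : ℝ) : expIter k (x : ℂ) = (realExpIter k x : ℂ) := by
  induction k with
  | zero => rfl
  | succ k ih => simp [expIter, realExpIter, ih]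

theorem tendsto_realExpIter (k : ℕ) :
    Filter.Tendsto (realExpIter k) Filter.atTop Filter.atTop := by
  induction k with
  | zero => exact Filter.tendsto_id
  | succ k ih => exact Real.tendsto_exp_atTop.comp ih

theorem prod_realExpIter_pow_isLittleO (i : ℕ) (a : ℕ → ℕ) :
    (fun x => ∏ j ∈ Finset.range i, realExpIter j x ^ a j) =o[Filter.atTop] realExpIter i := by
  induction i with
  | zero =>
    simp only [Finset.range_zero, Finset.prod_empty]
    exact (Asymptotics.isLittleO_const_left_of_ne one_ne_zero).2
      (tendsto_norm_atTop_atTop.comp (tendsto_realExpIter 0))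
  | succ i ih =>
    simp only [Finset.prod_range_succ]
    refine (ih.mul_isBigO (Asymptotics.isBigO_refl (fun x => realExpIter i x ^ a i) _)).trans ?_
    have h := (Real.isLittleO_pow_exp_atTop (n := a i + 1)).comp_tendsto (tendsto_realExpIter i)
    exact h.congr_left fun x => by simp [pow_succ']

theorem prod_realExpIter_pow_isLittleO_prod (N i : ℕ) (a b : ℕ → ℕ) (hi : i < N)
    (hlt : a i < b i) (heq : ∀ j, i < j → j < N → a j = b j) :
    (fun x => ∏ j ∈ Finset.range N, realExpIter j x ^ a j) =o[Filter.atTop]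
      (fun x => ∏ j ∈ Finset.range N, realExpIter j x ^ b j) := by
  induction N with
  | zero => omega
  | succ N ih =>
    simp only [Finset.prod_range_succ]
    rcases Nat.lt_succ_iff_lt_or_eq.1 hi with h | rfl
    · rw [heq N h N.lt_succ_self]
      exact (ih h fun j h₁ h₂ => heq j h₁ (by omega)).mul_isBigO (Asymptotics.isBigO_refl _ _)
    · refine ((prod_realExpIter_pow_isLittleO i a).mul_isBigO
        (Asymptotics.isBigO_refl (fun x => realExpIter i x ^ a i) _)).trans_isBigO ?_
      refine Asymptotics.IsBigO.of_bound 1 ?_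
      have hone : ∀ᶠ x in Filter.atTop, ∀ j ∈ Finset.range (i + 1), 1 ≤ realExpIter j x :=
        (Filter.eventually_all_finset _).2 fun j _ =>
          (tendsto_realExpIter j).eventually_ge_atTop 1
      filter_upwards [hone] with x hx
      have hxi := hx i (by simp)
      have hprod : 1 ≤ ∏ j ∈ Finset.range i, realExpIter j x ^ b j :=
        Finset.one_le_prod fun j hj =>
          one_le_pow₀ (hx j (Finset.mem_range.2 (by have := Finset.mem_range.1 hj; omega)))
      have hpow : realExpIter i x ^ (a i + 1) ≤ realExpIter i x ^ b i :=
        pow_le_pow_right₀ hxi hlt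
      rw [one_mul, ← pow_succ', Real.norm_of_nonneg (by positivity),
        Real.norm_of_nonneg (by positivity)]
      exact hpow.trans (le_mul_of_one_le_left (by positivity) hprod)

/-- The monomial in the iterated exponentials with exponent vector `a`, on the real line. -/
noncomputable def realExpMonomial {n : ℕ} (a : Fin n →₀ ℕ) (x : ℝ) : ℝ :=
  ∏ k : Fin n, realExpIter k x ^ a k

theorem realExpMonomial_isLittleO {n : ℕ} {a b : Fin n →₀ ℕ} (i : Fin n) (hlt : a i < b i)
    (heq : ∀ j, i < j → a j = b j) :
    realExpMonomial a =o[Filter.atTop] realExpMonomial b := by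
  have key (c : Fin n →₀ ℕ) : realExpMonomial c = fun x => ∏ j ∈ Finset.range n,
      realExpIter j x ^ (if h : j < n then c ⟨j, h⟩ else 0) := by
    funext x
    simp [Finset.prod_range, realExpMonomial]
  rw [key a, key b]
  refine prod_realExpIter_pow_isLittleO_prod n i _ _ i.2 (by simpa using hlt) fun j h₁ h₂ => ?_
  simpa [h₂] using heq ⟨j, h₂⟩ h₁

theorem aeval_expIter_ofReal {n : ℕ} (p : MvPolynomial (Fin n) ℂ) (x : ℝ) :
    MvPolynomial.aeval (fun k : Fin n => expIter k) p (x : ℂ) =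
      ∑ a ∈ p.support, p.coeff a * (realExpMonomial a x : ℂ) := by
  simp [MvPolynomial.aeval_def, MvPolynomial.eval₂_eq', expIter_ofReal, realExpMonomial,
    Finset.sum_apply, Finset.prod_apply]

/-- For every `n ≥ 1`, the `n + 1` entire functions
`z, e^z, e^{e^z}, …, exp_{(n)}` are algebraically independent over `ℂ`. -/
theorem iterated_exp_algebraically_independent (n : ℕ) (hn : 1 ≤ n) :
    AlgebraicIndependent ℂ (fun k : Fin (n + 1) => expIter k) := by
  rw [algebraicIndependent_iff]
  intro p hp
  by_contra hp0
  obtain ⟨m, hm, hmax⟩ := p.support.exists_max_image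
    (fun a => toLex fun i : Fin (n + 1) => a (Fin.rev i)) (MvPolynomial.support_nonempty.2 hp0)
  have hsmall : ∀ a ∈ p.support.erase m,
      (fun x => p.coeff a * (realExpMonomial a x : ℂ)) =o[Filter.atTop] realExpMonomial m := by
    intro a ha
    obtain ⟨hne, ha⟩ := Finset.mem_erase.1 ha
    have hlt : (toLex fun i : Fin (n + 1) => a (Fin.rev i)) < toLex fun i => m (Fin.rev i) := by
      refine lt_of_le_of_ne (hmax a ha) fun h => hne ?_
      ext i
      simpa using congrFun (toLex.injective h) (Fin.rev i)
    obtain ⟨i, heq, hi⟩ := hlt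
    have hlo : realExpMonomial a =o[Filter.atTop] realExpMonomial m :=
      realExpMonomial_isLittleO (Fin.rev i) hi fun j hj => by
        simpa using heq (Fin.rev j) (Fin.rev_lt_iff.1 hj)
    exact (Asymptotics.IsLittleO.of_norm_left (hlo.norm_left.congr_left fun x => by
      simp)).const_mul_left _
  have hsum := Asymptotics.IsLittleO.sum hsmall
  have hself : (fun x => (realExpMonomial m x : ℂ)) =o[Filter.atTop] realExpMonomial m := by
    rw [← Asymptotics.isLittleO_const_mul_left_iff
      (neg_ne_zero.2 (MvPolynomial.mem_support_iff.1 hm))]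
    refine hsum.congr_left fun x => ?_
    have hx := congrFun hp (x : ℂ)
    rw [aeval_expIter_ofReal, ← Finset.sum_erase_add _ _ hm] at hx
    simpa using eq_neg_of_add_eq_zero_left hx
  have hpos : ∀ᶠ x in Filter.atTop, realExpMonomial m x ≠ 0 := by
    have h : ∀ᶠ x in Filter.atTop, ∀ k : Fin (n + 1), 0 < realExpIter k x :=
      Filter.eventually_all.2 fun k => (tendsto_realExpIter k).eventually_gt_atTop 0
    filter_upwards [h] with x hx
    exact (Finset.prod_pos fun k _ => pow_pos (hx k) _).ne'
  refine Asymptotics.isLittleO_irrefl hpos.frequently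
    (Asymptotics.IsLittleO.of_norm_left (hself.norm_left.congr_left fun x => by simp))
end

section
/- Let P ∈ ℂ[X, Y] be a polynomial in two variables that is irreducible in ℂ[X, Y], has degree at least 1 in Y, and is not a scalar multiple of Y. Then there exist no entire function g and no integer m ≥ 2 such that P(z, e^z) = g(z)^m for all z ∈ ℂ. -/
open Complex MvPolynomial

open Filter in
/-- An entire function with finitely many zeros is a monic polynomial times a nowhere vanishing
entire function. -/
theorem exists_monic_mul_of_zeros_subset (S : Finset ℂ) {f : ℂ → ℂ} (hf : Differentiable ℂ f)
    (hS : ∀ z, f z = 0 → z ∈ S) :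
    ∃ (q : Polynomial ℂ) (u : ℂ → ℂ), q.Monic ∧ Differentiable ℂ u ∧ (∀ z, u z ≠ 0) ∧
      ∀ z, f z = q.eval z * u z := by
  induction S using Finset.induction_on generalizing f with
  | empty => exact ⟨1, f, Polynomial.monic_one, hf, fun z hz => by simpa using hS z hz, by simp⟩
  | insert a S _ ih =>
    obtain ⟨p, hp⟩ := hf.analyticAt a
    have hp0 : p ≠ 0 := by
      intro h
      have hinf : {z | f z = 0}.Infinite := infinite_of_mem_nhds a (hp.locally_zero_iff.mpr h)
      exact hinf ((insert a S).finite_toSet.subset fun z hz => hS z hz)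
    have hd : ∀ n : ℕ, Differentiable ℂ ((Function.swap dslope a)^[n] f) := by
      intro n
      induction n with
      | zero => exact hf
      | succ n ihn =>
        rw [Function.iterate_succ_apply']
        exact differentiableOn_univ.mp
          ((differentiableOn_dslope univ_mem).mpr ihn.differentiableOn)
    have hfac := hp.eq_pow_order_mul_iterate_dslope
    obtain ⟨q, u, hq, hu, hu0, hqu⟩ := ih (hd p.order) fun z hz => by
      refine (Finset.mem_insert.mp (hS z (by rw [hfac, hz, smul_zero]))).resolve_left ?_
      rintro rfl
      exact hp.iterate_dslope_fslope_ne_zero hp0 hz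
    refine ⟨(Polynomial.X - Polynomial.C a) ^ p.order * q, u,
      ((Polynomial.monic_X_sub_C a).pow _).mul hq, hu, hu0, fun z => ?_⟩
    rw [hfac, hqu]
    simp [mul_assoc]

/-- A nowhere vanishing entire function has an entire logarithm. -/
theorem exists_exp_eq_of_forall_ne_zero {u : ℂ → ℂ} (hu : Differentiable ℂ u)
    (hu0 : ∀ z, u z ≠ 0) : ∃ h : ℂ → ℂ, Differentiable ℂ h ∧ ∀ z, u z = exp (h z) := by
  obtain ⟨h, h0, hh⟩ := (hu.deriv.div hu hu0).isExactOn_univ.with_val_at 0 (log (u 0))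
  have hh' : ∀ z, HasDerivAt h (deriv u z / u z) z := fun z => hh z trivial
  refine ⟨h, fun z => (hh' z).differentiableAt, fun z => ?_⟩
  have hder : ∀ w, HasDerivAt (fun w => u w * exp (-h w)) 0 w := fun w => by
    refine ((hu w).hasDerivAt.mul (hh' w).neg.cexp).congr_deriv ?_
    linear_combination -exp (-h w) * mul_div_cancel₀ (deriv u w) (hu0 w)
  have hconst := is_const_of_deriv_eq_zero (fun w => (hder w).differentiableAt)
    (fun w => (hder w).deriv) z 0
  simp only [h0, exp_neg, exp_log (hu0 0), mul_inv_cancel₀ (hu0 0)] at hconst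
  exact eq_of_div_eq_one (by rw [div_eq_mul_inv, hconst])

/-- An entire function whose real part grows at most linearly is affine. -/
theorem exists_eq_affine_of_re_le {h : ℂ → ℂ} (hh : Differentiable ℂ h) {A B : ℝ}
    (hAB : ∀ z, (h z).re ≤ A + B * ‖z‖) : ∃ a b : ℂ, ∀ z, h z = a * z + b := by
  have hd : Differentiable ℂ (dslope h 0) := differentiableOn_univ.mp
    ((differentiableOn_dslope Filter.univ_mem).mpr hh.differentiableOn)
  set M₀ : ℝ := |A| + ‖h 0‖ + 1
  have hbd : ∀ z, ‖dslope h 0 z‖ ≤ 2 * M₀ + 4 * |B| + ‖dslope h 0 0‖ := by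
    intro z
    rcases eq_or_ne z 0 with rfl | hz
    · have : 0 ≤ M₀ := by positivity
      have := abs_nonneg B
      linarith
    have hr : 0 < ‖z‖ := norm_pos_iff.mpr hz
    have hM : 0 < M₀ + |B| * (2 * ‖z‖ + 1) := by positivity
    have hbc := borelCaratheodory_zero (f := fun w => h w - h 0) (R := 2 * ‖z‖ + 1) (z := z) hM
      (hh.sub_const _).differentiableOn (fun w hw => by
        have hw' : ‖w‖ < 2 * ‖z‖ + 1 := by simpa using hw
        have h1 := hAB w
        have h2 : B * ‖w‖ ≤ |B| * (2 * ‖z‖ + 1) :=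
          mul_le_mul (le_abs_self B) hw'.le (norm_nonneg _) (abs_nonneg _)
        have h3 := (abs_le.mp (abs_re_le_norm (h 0))).1
        have h4 := le_abs_self A
        simp only [Set.mem_ofPred_eq, sub_re, M₀]
        linarith) (by positivity) (by simp; linarith) (by simp)
    rw [dslope_of_ne _ hz, slope_def_field, sub_zero, norm_div, div_le_iff₀ hr]
    refine hbc.trans ?_
    rw [div_le_iff₀ (by linarith)]
    have h5 := norm_nonneg (dslope h 0 0)
    have h6 : 0 ≤ M₀ := by positivity
    have h7 := abs_nonneg B
    have : 0 ≤ ‖z‖ * (2 * M₀ * ‖z‖ + 2 * |B| + ‖dslope h 0 0‖ * (‖z‖ + 1)) := by positivity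
    nlinarith
  obtain ⟨a, ha⟩ := hd.exists_const_forall_eq_of_bounded
    (isBounded_iff_forall_norm_le.mpr ⟨_, by rintro _ ⟨z, rfl⟩; exact hbd z⟩)
  refine ⟨a, h 0, fun z => ?_⟩
  have := sub_smul_dslope h 0 z
  rw [ha] at this
  simp only [sub_zero, smul_eq_mul] at this
  linear_combination -this

open Filter in
/-- An entire function of exponential type with finitely many zeros is a polynomial times the
exponential of an affine function. -/
theorem exists_polynomial_mul_exp_of_zeros_subset (S : Finset ℂ) {f : ℂ → ℂ}
    (hf : Differentiable ℂ f) (hS : ∀ z, f z = 0 → z ∈ S) {A B : ℝ}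
    (hAB : ∀ z, ‖f z‖ ≤ A * Real.exp (B * ‖z‖)) :
    ∃ (q : Polynomial ℂ) (a b : ℂ), q ≠ 0 ∧ ∀ z, f z = q.eval z * exp (a * z + b) := by
  obtain ⟨q, u, hq, hu, hu0, hqu⟩ := exists_monic_mul_of_zeros_subset S hf hS
  obtain ⟨h, hh, hexp⟩ := exists_exp_eq_of_forall_ne_zero hu hu0
  obtain ⟨R, hR⟩ : ∃ R : ℝ, ∀ z : ℂ, R ≤ ‖z‖ → 1 ≤ ‖q.eval z‖ := by
    by_cases hdeg : 0 < q.degree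
    · have := (q.tendsto_norm_atTop hdeg
        (tendsto_norm_cobounded_atTop (E := ℂ))).eventually_ge_atTop 1
      rw [← comap_norm_atTop, eventually_comap, eventually_atTop] at this
      obtain ⟨R, hR⟩ := this
      exact ⟨R, fun z hz => hR _ hz z rfl⟩
    · have : q = 1 := hq.degree_le_zero_iff_eq_one.mp (not_lt.mp hdeg)
      exact ⟨0, fun z _ => by simp [this]⟩
  obtain ⟨K, hK⟩ := (isCompact_closedBall (0 : ℂ) R).exists_bound_of_continuousOn
    hu.continuous.continuousOn
  have hB : B ≤ |B| := le_abs_self B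
  have hbound : ∀ z, ‖u z‖ ≤ (|A| + |K| + 1) * Real.exp (|B| * ‖z‖) := by
    intro z
    have hone : 1 ≤ Real.exp (|B| * ‖z‖) := Real.one_le_exp (by positivity)
    rcases le_total R ‖z‖ with hz | hz
    · calc ‖u z‖ ≤ ‖q.eval z‖ * ‖u z‖ := le_mul_of_one_le_left (norm_nonneg _) (hR z hz)
        _ = ‖f z‖ := by rw [hqu, norm_mul]
        _ ≤ A * Real.exp (B * ‖z‖) := hAB z
        _ ≤ (|A| + |K| + 1) * Real.exp (|B| * ‖z‖) := by
          gcongr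
          linarith [le_abs_self A, abs_nonneg K]
    · calc ‖u z‖ ≤ |A| + |K| + 1 := by
            linarith [hK z (by simpa using hz), le_abs_self K, abs_nonneg A]
        _ ≤ _ := le_mul_of_one_le_right (by positivity) hone
  obtain ⟨a, b, hab⟩ := exists_eq_affine_of_re_le hh (A := Real.log (|A| + |K| + 1)) (B := |B|)
    fun z => by
      have := hbound z
      rw [hexp, norm_exp] at this
      have := Real.log_le_log (Real.exp_pos _) this
      rwa [Real.log_exp, Real.log_mul (by positivity) (by positivity), Real.log_exp] at this
  exact ⟨q, a, b, hq.ne_zero, fun z => by rw [hqu, hexp, hab]⟩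

open scoped Polynomial Polynomial.Bivariate

/-- The derivation `∂/∂X + Y ∂/∂Y` of `ℂ[X][Y]`, which corresponds to differentiation after the
substitution `X = z`, `Y = exp z`. -/
noncomputable def expDerivative (p : ℂ[X][Y]) : ℂ[X][Y] :=
  PolynomialModule.equivPolynomialSelf (Polynomial.derivative'.mapCoeffs p) +
    Polynomial.X * Polynomial.derivative p

theorem coeff_expDerivative (p : ℂ[X][Y]) (k : ℕ) :
    (expDerivative p).coeff k = Polynomial.derivative (p.coeff k) + (k : ℂ[X]) * p.coeff k := by
  have h : (PolynomialModule.equivPolynomialSelf (Polynomial.derivative'.mapCoeffs p)).coeff k =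
    Polynomial.derivative (p.coeff k) := rfl
  rw [expDerivative, Polynomial.coeff_add, h]
  cases k with
  | zero => simp
  | succ k => simp [Polynomial.coeff_X_mul, Polynomial.coeff_derivative, mul_comm]

theorem natDegree_expDerivative_le (p : ℂ[X][Y]) :
    (expDerivative p).natDegree ≤ p.natDegree := by
  refine Polynomial.natDegree_le_iff_coeff_eq_zero.mpr fun k hk => ?_
  simp [coeff_expDerivative, Polynomial.coeff_eq_zero_of_natDegree_lt hk]

theorem expDerivative_add (p q : ℂ[X][Y]) :
    expDerivative (p + q) = expDerivative p + expDerivative q := by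
  ext1 k
  simp only [coeff_expDerivative, Polynomial.coeff_add, Polynomial.derivative_add]
  ring

theorem expDerivative_monomial (k : ℕ) (a : ℂ[X]) :
    expDerivative (Polynomial.monomial k a) =
      Polynomial.monomial k (Polynomial.derivative a + (k : ℂ[X]) * a) := by
  ext1 j
  rw [coeff_expDerivative, Polynomial.coeff_monomial, Polynomial.coeff_monomial]
  split_ifs with h <;> simp [h]

theorem hasDerivAt_evalEval_exp (p : ℂ[X][Y]) (z : ℂ) :
    HasDerivAt (fun z => p.evalEval z (exp z)) ((expDerivative p).evalEval z (exp z)) z := by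
  induction p using Polynomial.induction_on' with
  | add p q hp hq =>
    simp only [expDerivative_add, Polynomial.evalEval_add]
    exact hp.add hq
  | monomial k a =>
    simp only [expDerivative_monomial, Polynomial.evalEval, Polynomial.eval_monomial,
      Polynomial.eval_mul, Polynomial.eval_pow, Polynomial.eval_C, Polynomial.eval_add,
      Polynomial.eval_natCast]
    have h : HasDerivAt (fun z => exp z ^ k) (k * exp z ^ k) z := by
      simp only [← exp_nat_mul]
      simpa [mul_comm] using ((hasDerivAt_id z).const_mul (k : ℂ)).cexp
    refine ((a.hasDerivAt z).mul h).congr_deriv ?_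
    ring

/-- The functions `z` and `exp z` are algebraically independent. -/
theorem eq_zero_of_evalEval_exp_eq_zero {p : ℂ[X][Y]}
    (hp : ∀ z, p.evalEval z (exp z) = 0) : p = 0 := by
  have hfix : ∀ z x : ℂ, p.evalEval x (exp z) = 0 := by
    intro z
    have hzero : p.eval (Polynomial.C (exp z)) = 0 := by
      refine Polynomial.eq_zero_of_infinite_isRoot _ (Set.infinite_of_injective_forall_mem
        (f := fun n : ℕ => z + n * (2 * Real.pi * I)) (fun m n hmn => ?_) fun n => ?_)
      · simpa [Real.pi_ne_zero] using hmn
      · have := hp (z + n * (2 * Real.pi * I))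
        rwa [exp_periodic.nat_mul n z] at this
    intro x
    rw [Polynomial.evalEval, hzero, Polynomial.eval_zero]
  refine Polynomial.eq_zero_of_infinite_isRoot _ (Set.infinite_of_injective_forall_mem
        (f := fun n : ℕ => (Polynomial.C ((n : ℂ) + 1) : ℂ[X])) (fun m n hmn => ?_) fun n => ?_)
  · simpa using hmn
  · refine Polynomial.funext fun x => ?_
    have := hfix (log ((n : ℂ) + 1)) x
    rw [exp_log (Nat.cast_add_one_ne_zero n)] at this
    simpa [Polynomial.evalEval] using this

/-- The function `z ↦ p (z, exp z)` is of exponential type. -/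
theorem exists_norm_evalEval_exp_le (p : ℂ[X][Y]) :
    ∃ A B : ℝ, 0 ≤ A ∧ 0 ≤ B ∧ ∀ z, ‖p.evalEval z (exp z)‖ ≤ A * Real.exp (B * ‖z‖) := by
  have hadd : ∀ {p q : ℂ[X][Y]},
      (∃ A B : ℝ, 0 ≤ A ∧ 0 ≤ B ∧ ∀ z, ‖p.evalEval z (exp z)‖ ≤ A * Real.exp (B * ‖z‖)) →
      (∃ A B : ℝ, 0 ≤ A ∧ 0 ≤ B ∧ ∀ z, ‖q.evalEval z (exp z)‖ ≤ A * Real.exp (B * ‖z‖)) →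
      ∃ A B : ℝ, 0 ≤ A ∧ 0 ≤ B ∧ ∀ z, ‖(p + q).evalEval z (exp z)‖ ≤ A * Real.exp (B * ‖z‖) := by
    rintro p q ⟨A, B, hA, hB, hp⟩ ⟨A', B', hA', hB', hq⟩
    refine ⟨A + A', B + B', by positivity, by positivity, fun z => ?_⟩
    rw [Polynomial.evalEval_add, add_mul]
    refine (norm_add_le _ _).trans (add_le_add ((hp z).trans ?_) ((hq z).trans ?_)) <;>
      gcongr <;> linarith
  induction p using Polynomial.induction_on' with
  | add p q hp hq => exact hadd hp hq
  | monomial k a =>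
    induction a using Polynomial.induction_on' with
    | add a b ha hb =>
      rw [map_add]
      exact hadd ha hb
    | monomial n c =>
      refine ⟨‖c‖, n + k, norm_nonneg _, by positivity, fun z => ?_⟩
      have hz : ‖z‖ ≤ Real.exp ‖z‖ := by linarith [Real.add_one_le_exp ‖z‖]
      simp only [Polynomial.evalEval, Polynomial.eval_monomial, Polynomial.eval_mul,
        Polynomial.eval_pow, Polynomial.eval_C, norm_mul, norm_pow, add_mul, Real.exp_add,
        Real.exp_nat_mul, ← mul_assoc]
      gcongr
      exact norm_exp_le_exp_norm z

/-- A polynomial dividing its own `expDerivative` is a monomial in `Y` with constant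
coefficient. -/
theorem eq_monomial_of_dvd_expDerivative {p : ℂ[X][Y]} (hp : p ∣ expDerivative p) :
    ∃ c : ℂ, p = Polynomial.monomial p.natDegree (Polynomial.C c) := by
  rcases eq_or_ne p 0 with rfl | hp0
  · exact ⟨0, by simp⟩
  have aux : ∀ {a c : ℂ[X]}, a ≠ 0 → Polynomial.derivative a = c * a → c = 0 := by
    intro a c ha hac
    by_contra hc
    have h1 := Polynomial.degree_derivative_lt ha
    rw [hac, Polynomial.degree_mul] at h1
    have h2 := Polynomial.zero_le_degree_iff.mpr hc
    exact absurd h1 (not_lt.mpr (le_add_of_nonneg_left h2))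
  obtain ⟨t, ht⟩ := hp
  obtain ⟨s, rfl⟩ : ∃ s, t = Polynomial.C s := by
    refine ⟨t.coeff 0, Polynomial.eq_C_of_natDegree_eq_zero ?_⟩
    rcases eq_or_ne t 0 with rfl | ht0
    · simp
    have := natDegree_expDerivative_le p
    rw [ht, Polynomial.natDegree_mul hp0 ht0] at this
    omega
  have hk : ∀ k : ℕ, Polynomial.derivative (p.coeff k) = (s - (k : ℂ[X])) * p.coeff k := by
    intro k
    have := congrArg (Polynomial.coeff · k) ht
    simp only [coeff_expDerivative, Polynomial.coeff_mul_C] at this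
    linear_combination this
  have hs : s = (p.natDegree : ℂ[X]) :=
    sub_eq_zero.mp (aux (Polynomial.leadingCoeff_ne_zero.mpr hp0) (hk p.natDegree))
  have hlead := hk p.natDegree
  rw [hs, sub_self, zero_mul] at hlead
  refine ⟨(p.coeff p.natDegree).coeff 0, ?_⟩
  ext1 k
  rw [Polynomial.coeff_monomial]
  split_ifs with h
  · rw [← h]
    exact Polynomial.eq_C_of_natDegree_eq_zero (Polynomial.derivative_eq_zero.mp hlead)
  · by_contra hne
    have := aux hne (hk k)
    rw [hs, sub_eq_zero, Nat.cast_inj] at this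
    exact h this

/-- An irreducible polynomial of positive degree over a GCD domain, and a polynomial it does not
divide, generate an ideal containing a nonzero constant. -/
theorem exists_mul_add_mul_eq_C_of_irreducible {R : Type*} [CommRing R] [IsDomain R]
    [IsGCDMonoid R] {p q : R[X]} (hp : Irreducible p) (hdeg : p.natDegree ≠ 0) (hpq : ¬ p ∣ q) :
    ∃ (a b : R[X]) (r : R), r ≠ 0 ∧ p * a + q * b = Polynomial.C r := by
  let K := FractionRing R
  have hprim := hp.isPrimitive hdeg
  have hcop : IsCoprime (p.map (algebraMap R K)) (q.map (algebraMap R K)) :=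
    ((hprim.irreducible_iff_irreducible_map_fraction_map (K := K)).mp hp).coprime_iff_not_dvd.mpr
      fun h => hpq (hprim.dvd_of_fraction_map_dvd_fraction_map (K := K) h)
  obtain ⟨a, b, -, -, hab⟩ := Polynomial.exists_mul_add_mul_eq_C_resultant p q le_rfl le_rfl
    (Or.inl hdeg)
  refine ⟨a, b, _, fun h => ?_, hab⟩
  have hinj := FaithfulSMul.algebraMap_injective R K
  have := Polynomial.resultant_map_map p q p.natDegree q.natDegree (algebraMap R K)
  rw [h, map_zero, ← Polynomial.natDegree_map_eq_of_injective hinj p,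
    ← Polynomial.natDegree_map_eq_of_injective hinj q, Polynomial.resultant_eq_zero_iff] at this
  exact this.2 hcop

/-- If `p ∈ ℂ[X][Y]` is irreducible of positive degree in `Y` and not a scalar multiple of `Y`,
then `z ↦ p (z, exp z)` is not a proper power of an entire function. -/
theorem evalEval_exp_ne_pow {p : ℂ[X][Y]} (hp : Irreducible p) (hdeg : p.natDegree ≠ 0)
    (hY : ∀ c : ℂ, p ≠ Polynomial.C (Polynomial.C c) * Polynomial.X) {g : ℂ → ℂ}
    (hg : Differentiable ℂ g) {m : ℕ} (hm : 2 ≤ m) :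
    ¬ ∀ z, p.evalEval z (exp z) = g z ^ m := by
  intro h
  have hdvd : ¬ p ∣ expDerivative p := by
    intro hd
    obtain ⟨c, hc⟩ := eq_monomial_of_dvd_expDerivative hd
    have hX : Polynomial.X ∣ p := by
      rw [hc, ← Polynomial.C_mul_X_pow_eq_monomial]
      exact (dvd_pow_self _ hdeg).mul_left _
    have hassoc := Polynomial.irreducible_X.associated_of_dvd hp hX
    have h1 : p.natDegree = 1 := by
      rw [← Polynomial.natDegree_eq_of_degree_eq (Polynomial.degree_eq_degree_of_associated hassoc),
        Polynomial.natDegree_X]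
    rw [h1, ← Polynomial.C_mul_X_eq_monomial] at hc
    exact hY c hc
  obtain ⟨a, b, r, hr, hab⟩ := exists_mul_add_mul_eq_C_of_irreducible hp hdeg hdvd
  have hzero : ∀ z, p.evalEval z (exp z) = 0 → z ∈ r.roots.toFinset := by
    intro z hz
    have hgz : g z = 0 := pow_eq_zero_iff (by omega) |>.mp ((h z).symm.trans hz)
    have hder : (expDerivative p).evalEval z (exp z) = 0 := by
      refine (hasDerivAt_evalEval_exp p z).unique ?_
      rw [funext h]
      refine ((hg z).hasDerivAt.pow m).congr_deriv ?_
      simp [hgz, show m - 1 ≠ 0 by omega]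
    have := congrArg (Polynomial.evalEval z (exp z)) hab
    simp only [Polynomial.evalEval_add, Polynomial.evalEval_mul, hz, hder, zero_mul, add_zero,
      Polynomial.evalEval_C] at this
    simp [hr, ← this]
  obtain ⟨A, B, -, -, hAB⟩ := exists_norm_evalEval_exp_le p
  obtain ⟨q, α, β, hq, hqe⟩ := exists_polynomial_mul_exp_of_zeros_subset _
    (fun z => (hasDerivAt_evalEval_exp p z).differentiableAt) hzero hAB
  have hid : p * (Polynomial.C (Polynomial.derivative q + Polynomial.C α * q)) =
      Polynomial.C q * expDerivative p := by
    refine sub_eq_zero.mp (eq_zero_of_evalEval_exp_eq_zero fun z => ?_)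
    have hder : (expDerivative p).evalEval z (exp z) =
        q.derivative.eval z * exp (α * z + β) + q.eval z * (exp (α * z + β) * α) := by
      refine (hasDerivAt_evalEval_exp p z).unique ?_
      rw [funext hqe]
      have hlin : HasDerivAt (fun z => α * z + β) α z := by
        simpa using ((hasDerivAt_id z).const_mul α).add_const β
      exact (q.hasDerivAt z).mul hlin.cexp
    simp only [Polynomial.evalEval_sub, Polynomial.evalEval_mul, Polynomial.evalEval_C, hder, hqe,
      Polynomial.eval_add, Polynomial.eval_mul, Polynomial.eval_C]
    ring
  rcases hp.prime.dvd_or_dvd ⟨_, hid.symm⟩ with hC | hD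
  · have := Polynomial.natDegree_le_of_dvd hC (Polynomial.C_ne_zero.mpr hq)
    rw [Polynomial.natDegree_C] at this
    omega
  · exact hdvd hD

theorem degreeOf_one_equivMvPolynomial_C {R : Type*} [CommSemiring R] [Nontrivial R]
    (a : R[X]) :
    (Polynomial.Bivariate.equivMvPolynomial R (Polynomial.C a)).degreeOf 1 = 0 := by
  induction a using Polynomial.induction_on' with
  | add a b ha hb =>
    rw [map_add, map_add]
    exact Nat.le_zero.mp ((degreeOf_add_le _ _ _).trans (by simp [ha, hb]))
  | monomial n c =>
    rw [← Polynomial.C_mul_X_pow_eq_monomial]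
    simp only [map_mul, map_pow, Polynomial.Bivariate.equivMvPolynomial_C_C,
      Polynomial.Bivariate.equivMvPolynomial_C_X]
    refine Nat.le_zero.mp ((degreeOf_C_mul_le _ _ _).trans ((degreeOf_pow_le _ _ _).trans ?_))
    simp [degreeOf_X]

theorem eval_equivMvPolynomial {R : Type*} [CommSemiring R] (p : R[X][Y]) (x y : R) :
    MvPolynomial.eval ![x, y] (Polynomial.Bivariate.equivMvPolynomial R p) = p.evalEval x y := by
  induction p using Polynomial.induction_on' with
  | add p q hp hq => simp [hp, hq]
  | monomial n a =>
    induction a using Polynomial.induction_on' with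
    | add a b ha hb => rw [map_add, map_add, map_add, ha, hb, Polynomial.evalEval_add]
    | monomial k a =>
      simp [← Polynomial.C_mul_X_pow_eq_monomial, Polynomial.evalEval]

/-- If `P ∈ ℂ[X, Y]` is irreducible, has degree at least `1` in `Y`, and is not a scalar
multiple of `Y`, then `z ↦ P (z, e^z)` is not an `m`-th power (`m ≥ 2`) of any entire
function. -/
theorem exp_polynomial_not_a_power
    (P : MvPolynomial (Fin 2) ℂ) (hP : Irreducible P)
    (hdeg : 1 ≤ P.degreeOf 1)
    (hY : ¬ ∃ c : ℂ, P = MvPolynomial.C c * MvPolynomial.X 1) :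
    ¬ ∃ (g : ℂ → ℂ) (m : ℕ), Differentiable ℂ g ∧ 2 ≤ m ∧
        ∀ z : ℂ, MvPolynomial.eval ![z, Complex.exp z] P = g z ^ m := by
  rintro ⟨g, m, hg, hm, h⟩
  obtain ⟨p, rfl⟩ := (Polynomial.Bivariate.equivMvPolynomial ℂ).surjective P
  simp only [eval_equivMvPolynomial] at h
  refine evalEval_exp_ne_pow ((MulEquiv.irreducible_iff _).mp hP) (fun hd => ?_)
    (fun c hc => hY ⟨c, ?_⟩) hg hm h
  · rw [Polynomial.eq_C_of_natDegree_eq_zero hd, degreeOf_one_equivMvPolynomial_C] at hdeg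
    omega
  · simp [hc]
end
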